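/- arXiv:1901.01530 — 6 statements merged into one kernel-verified Lean document; each statement's English description precedes it below -/
import Mathlib

section
/- The function ξ(s) = 1 − s·tanh(s) satisfies ξ'' + 2·cosh(s)^{-2}·ξ = 0 on ℝ, is strictly positive for s ∈ (−T,T), and vanishes at s = T and s = −T. -/
theorem Real.hasDerivAt_tanh (x : ℝ) : HasDerivAt Real.tanh (1 / Real.cosh x ^ 2) x := by
  have h := (Real.hasDerivAt_sinh x).div (Real.hasDerivAt_cosh x) (Real.cosh_pos x).ne'
  rw [show Real.tanh = Real.sinh / Real.cosh from funext Real.tanh_eq_sinh_div_cosh]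
  refine h.congr_deriv ?_
  rw [← Real.cosh_sq_sub_sinh_sq x]
  ring

theorem Real.tanh_strictMono : StrictMono Real.tanh :=
  strictMono_of_hasDerivAt_pos Real.hasDerivAt_tanh fun x => by
    have := Real.cosh_pos x
    positivity

theorem hasDerivAt_one_sub_mul_tanh (s : ℝ) :
    HasDerivAt (fun x => 1 - x * Real.tanh x) (-Real.tanh s - s / Real.cosh s ^ 2) s := by
  have h := ((hasDerivAt_id s).mul (Real.hasDerivAt_tanh s)).const_sub 1
  refine h.congr_deriv ?_
  simp only [id_eq]
  ring

theorem hasDerivAt_neg_tanh_sub_div_cosh_sq (s : ℝ) :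
    HasDerivAt (fun x => -Real.tanh x - x / Real.cosh x ^ 2)
      (-(2 / Real.cosh s ^ 2 * (1 - s * Real.tanh s))) s := by
  have hc : Real.cosh s ≠ 0 := (Real.cosh_pos s).ne'
  have h := (Real.hasDerivAt_tanh s).neg.sub
    ((hasDerivAt_id s).div ((Real.hasDerivAt_cosh s).pow 2) (pow_ne_zero 2 hc))
  refine h.congr_deriv ?_
  simp only [id_eq, Pi.pow_apply, Real.tanh_eq_sinh_div_cosh]
  field_simp
  ring

/-- The function `ξ(s) = 1 - s·tanh s` satisfies `ξ'' + 2 cosh(s)⁻² ξ = 0` on `ℝ`,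
is strictly positive on `(-T, T)`, and vanishes at `s = T` and `s = -T`,
where `T` is the unique positive real with `T·tanh T = 1`. -/
theorem xi_first_dirichlet_eigenfunction (T : ℝ) (hT : 0 < T)
    (hTtanh : T * Real.tanh T = 1) :
    (∀ s : ℝ,
        iteratedDeriv 2 (fun s' => 1 - s' * Real.tanh s') s
          + 2 / (Real.cosh s) ^ 2 * (1 - s * Real.tanh s) = 0) ∧
    (∀ s ∈ Set.Ioo (-T) T, 0 < 1 - s * Real.tanh s) ∧
    (1 - T * Real.tanh T = 0) ∧ (1 - (-T) * Real.tanh (-T) = 0) := by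
  refine ⟨fun s => ?_, fun s hs => ?_, by linarith, by rw [Real.tanh_neg]; linarith⟩
  · rw [iteratedDeriv_succ, iteratedDeriv_one,
      funext fun x => (hasDerivAt_one_sub_mul_tanh x).deriv,
      (hasDerivAt_neg_tanh_sub_div_cosh_sq s).deriv]
    ring
  · have hT' : 0 < Real.tanh T := by
      by_contra! h
      nlinarith
    have h1 : Real.tanh s < Real.tanh T := Real.tanh_strictMono hs.2
    have h2 : -Real.tanh T < Real.tanh s := by
      rw [← Real.tanh_neg]
      exact Real.tanh_strictMono hs.1
    rcases le_total 0 s with h | h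
    · nlinarith [hs.2]
    · nlinarith [hs.1]
end

section
/- For the function u(s,θ) = tanh(s), one has B(u,u) = −2·N₂(u); explicitly, 2π·(∫_{−T}^{T}(cosh(s)^{-4} − 2·cosh(s)^{-2}·tanh(s)²) ds − (2/T)·tanh(T)²) = −4π·a²·∫_{−T}^{T} sinh(s)² ds. -/
open Real intervalIntegral

/-- The index form of the critical catenoid, for `2π`-periodic functions on `[-T,T] × ℝ`. -/
noncomputable def indexForm (T : ℝ) (u w : ℝ → ℝ → ℝ) : ℝ :=
  (∫ θ in (0:ℝ)..(2 * Real.pi), ∫ s in (-T)..T,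
      (deriv (fun s' => u s' θ) s * deriv (fun s' => w s' θ) s
        + deriv (fun θ' => u s θ') θ * deriv (fun θ' => w s θ') θ
        - 2 / (Real.cosh s) ^ 2 * u s θ * w s θ))
  - (1 / T) * ∫ θ in (0:ℝ)..(2 * Real.pi),
      (u T θ * w T θ + u (-T) θ * w (-T) θ)

/-- The squared `L²` norm on the critical catenoid (conformal factor `a² cosh² s`). -/
noncomputable def catL2 (T a : ℝ) (u : ℝ → ℝ → ℝ) : ℝ :=
  a ^ 2 * ∫ θ in (0:ℝ)..(2 * Real.pi), ∫ s in (-T)..T,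
    (Real.cosh s) ^ 2 * (u s θ) ^ 2

theorem hasDerivAt_tanh_one_div_cosh_sq (s : ℝ) :
    HasDerivAt Real.tanh (1 / Real.cosh s ^ 2) s := by
  have hc := (Real.cosh_pos s).ne'
  have h := (Real.hasDerivAt_sinh s).div (Real.hasDerivAt_cosh s) hc
  have hfun : Real.tanh = Real.sinh / Real.cosh := by
    funext x
    exact Real.tanh_eq_sinh_div_cosh x
  rw [hfun]
  refine h.congr_deriv ?_
  rw [← Real.cosh_sq_sub_sinh_sq s]
  ring

theorem one_div_cosh_sq_eq (s : ℝ) : 1 / Real.cosh s ^ 2 = 1 - Real.tanh s ^ 2 := by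
  have hc := (Real.cosh_pos s).ne'
  rw [Real.tanh_eq_sinh_div_cosh]
  field_simp
  linarith [Real.cosh_sq s]

theorem integral_cosh_tanh (T : ℝ) :
    ∫ s in (-T)..T, (1 / Real.cosh s ^ 4 - 2 / Real.cosh s ^ 2 * Real.tanh s ^ 2)
      = 2 * (Real.tanh T - Real.tanh T ^ 3) := by
  rw [integral_eq_sub_of_hasDerivAt (f := fun s => Real.tanh s - Real.tanh s ^ 3)]
  · rw [Real.tanh_neg]
    ring
  · intro s _
    have h := hasDerivAt_tanh_one_div_cosh_sq s
    refine (h.sub (h.pow 3)).congr_deriv ?_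
    have h4 : 1 / Real.cosh s ^ 4 = (1 / Real.cosh s ^ 2) * (1 / Real.cosh s ^ 2) := by ring
    have h2 : 2 / Real.cosh s ^ 2 = 2 * (1 / Real.cosh s ^ 2) := by ring
    rw [h4, h2, one_div_cosh_sq_eq]
    push_cast
    ring
  · have ht : Continuous Real.tanh :=
      continuous_iff_continuousAt.2 fun s => (hasDerivAt_tanh_one_div_cosh_sq s).continuousAt
    refine Continuous.intervalIntegrable ?_ _ _
    have hc : ∀ n : ℕ, ∀ s, Real.cosh s ^ n ≠ 0 := fun n s => (pow_pos (Real.cosh_pos s) n).ne'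
    exact (continuous_const.div (Real.continuous_cosh.pow 4) (hc 4)).sub
      ((continuous_const.div (Real.continuous_cosh.pow 2) (hc 2)).mul (ht.pow 2))

theorem integral_sinh_sq_symm (T : ℝ) :
    ∫ s in (-T)..T, Real.sinh s ^ 2 = Real.sinh T * Real.cosh T - T := by
  rw [integral_eq_sub_of_hasDerivAt
    (f := fun s => (Real.sinh s * Real.cosh s - s) / 2)]
  · simp only [Real.sinh_neg, Real.cosh_neg]
    ring
  · intro s _
    refine ((((Real.hasDerivAt_sinh s).mul (Real.hasDerivAt_cosh s)).sub
      (hasDerivAt_id s)).div_const 2).congr_deriv ?_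
    linarith [Real.cosh_sq s]
  · exact (Real.continuous_sinh.pow 2).intervalIntegrable _ _

theorem indexForm_tanh (T : ℝ) :
    indexForm T (fun s _ => Real.tanh s) (fun s _ => Real.tanh s)
      = 2 * Real.pi * ((∫ s in (-T)..T,
          (1 / Real.cosh s ^ 4 - 2 / Real.cosh s ^ 2 * Real.tanh s ^ 2))
          - (2 / T) * Real.tanh T ^ 2) := by
  have hint : ∀ s : ℝ, deriv (fun s' => Real.tanh s') s * deriv (fun s' => Real.tanh s') s
      + 0 * 0 - 2 / Real.cosh s ^ 2 * Real.tanh s * Real.tanh s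
      = 1 / Real.cosh s ^ 4 - 2 / Real.cosh s ^ 2 * Real.tanh s ^ 2 := by
    intro s
    rw [(hasDerivAt_tanh_one_div_cosh_sq s).deriv]
    ring
  simp only [indexForm, deriv_const, hint, integral_const, smul_eq_mul, Real.tanh_neg]
  ring

theorem catL2_tanh (T a : ℝ) :
    catL2 T a (fun s _ => Real.tanh s)
      = 2 * Real.pi * a ^ 2 * ∫ s in (-T)..T, Real.sinh s ^ 2 := by
  have hint : ∀ s : ℝ, Real.cosh s ^ 2 * Real.tanh s ^ 2 = Real.sinh s ^ 2 := by
    intro s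
    have hc := (Real.cosh_pos s).ne'
    rw [Real.tanh_eq_sinh_div_cosh]
    field_simp
  simp only [catL2, hint, integral_const, smul_eq_mul]
  ring

/-- For `u(s,θ) = tanh s` one has `B(u,u) = -2 N₂(u)`; explicitly,
`2π (∫_{-T}^T (cosh⁻⁴ s - 2 cosh⁻² s tanh² s) ds - (2/T) tanh² T)
  = -4π a² ∫_{-T}^T sinh² s ds`. -/
theorem fraser_schoen_identity_vertical (T a : ℝ) (hT : 0 < T)
    (hTtanh : T * Real.tanh T = 1) (ha : a = 1 / (T * Real.cosh T)) :
    indexForm T (fun s _θ => Real.tanh s) (fun s _θ => Real.tanh s)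
      = -2 * catL2 T a (fun s _θ => Real.tanh s) ∧
    2 * Real.pi * ((∫ s in (-T)..T,
        (1 / (Real.cosh s) ^ 4 - 2 / (Real.cosh s) ^ 2 * (Real.tanh s) ^ 2))
        - (2 / T) * (Real.tanh T) ^ 2)
      = -4 * Real.pi * a ^ 2 * ∫ s in (-T)..T, (Real.sinh s) ^ 2 := by
  have key : 2 * Real.pi * ((∫ s in (-T)..T,
        (1 / (Real.cosh s) ^ 4 - 2 / (Real.cosh s) ^ 2 * (Real.tanh s) ^ 2))
        - (2 / T) * (Real.tanh T) ^ 2)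
      = -4 * Real.pi * a ^ 2 * ∫ s in (-T)..T, (Real.sinh s) ^ 2 := by
    rw [integral_cosh_tanh, integral_sinh_sq_symm, ha]
    have hc := (Real.cosh_pos T).ne'
    have hsinh : Real.sinh T = Real.tanh T * Real.cosh T := by
      rw [Real.tanh_eq_sinh_div_cosh]
      field_simp
    have htanh : Real.tanh T = 1 / T := by
      field_simp
      linarith
    have hsq := one_div_cosh_sq_eq T
    have harea : (1 / (T * Real.cosh T)) ^ 2 * (Real.sinh T * Real.cosh T - T)
        = (1 / T) ^ 3 - 1 / T * (1 / Real.cosh T ^ 2) := by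
      rw [hsinh, htanh]
      field_simp
    rw [mul_assoc (-4 * Real.pi), harea, hsq, htanh]
    ring
  refine ⟨?_, key⟩
  rw [indexForm_tanh, catL2_tanh, key]
  ring
end

section
/- For each of the functions u(s,θ) = cos(θ)/cosh(s) and u(s,θ) = sin(θ)/cosh(s), one has B(u,u) = −2·N₂(u). -/
/-- The identity `B(u,u) = -2 N₂(u)` for a product `u(s,θ) = g(θ) / cosh s`, where `g` and its
derivative `h` are normalized like `cos` and `sin`. -/
theorem indexForm_div_cosh {T a : ℝ} (hT : 0 < T) (hTtanh : T * Real.tanh T = 1)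
    (ha : a = 1 / (T * Real.cosh T)) {g h : ℝ → ℝ} (hg : ∀ θ, HasDerivAt g (h θ) θ)
    (hh : Continuous h) (hgint : ∫ θ in (0:ℝ)..(2 * Real.pi), g θ ^ 2 = Real.pi)
    (hhint : ∫ θ in (0:ℝ)..(2 * Real.pi), h θ ^ 2 = Real.pi) :
    indexForm T (fun s θ => g θ / Real.cosh s) (fun s θ => g θ / Real.cosh s) =
      -2 * catL2 T a (fun s θ => g θ / Real.cosh s) := by
  have hcosh (s : ℝ) : Real.cosh s ≠ 0 := (Real.cosh_pos s).ne'
  have hgc : Continuous g := continuous_iff_continuousAt.2 fun θ => (hg θ).continuousAt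
  have hds (s θ : ℝ) : deriv (fun s' => g θ / Real.cosh s') s =
      -(g θ * Real.sinh s) / Real.cosh s ^ 2 := by
    simpa using ((hasDerivAt_const s (g θ)).fun_div (Real.hasDerivAt_cosh s) (hcosh s)).deriv
  have hdθ (s θ : ℝ) : deriv (fun θ' => g θ' / Real.cosh s) θ = h θ / Real.cosh s :=
    ((hg θ).div_const _).deriv
  have hinner (θ : ℝ) : (∫ s in (-T)..T,
      (-(g θ * Real.sinh s) / Real.cosh s ^ 2 * (-(g θ * Real.sinh s) / Real.cosh s ^ 2)
        + h θ / Real.cosh s * (h θ / Real.cosh s)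
        - 2 / (Real.cosh s) ^ 2 * (g θ / Real.cosh s) * (g θ / Real.cosh s))) =
      (2 * Real.tanh T ^ 3 - 4 * Real.tanh T) * g θ ^ 2 + 2 * Real.tanh T * h θ ^ 2 := by
    rw [intervalIntegral.integral_eq_sub_of_hasDerivAt
      (f := fun s => g θ ^ 2 * ((Real.sinh s / Real.cosh s) ^ 3 - 2 * (Real.sinh s / Real.cosh s))
        + h θ ^ 2 * (Real.sinh s / Real.cosh s))]
    · rw [Real.tanh_eq_sinh_div_cosh, Real.sinh_neg, Real.cosh_neg]
      ring
    · intro s _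
      have ht := (Real.hasDerivAt_sinh s).fun_div (Real.hasDerivAt_cosh s) (hcosh s)
      convert (((ht.fun_pow 3).fun_sub (ht.const_mul 2)).const_mul (g θ ^ 2)).fun_add
        (ht.const_mul (h θ ^ 2)) using 1
      have hc := hcosh s
      have hsq := Real.cosh_sq s
      have h1 : Real.cosh s * Real.cosh s - Real.sinh s * Real.sinh s = 1 := by linarith
      rw [h1]
      norm_num only [Nat.cast_ofNat]
      field_simp
      rw [hsq]
      ring
    · apply Continuous.intervalIntegrable
      fun_prop (disch := simp [hcosh])
  have hbdry (θ : ℝ) : g θ / Real.cosh T * (g θ / Real.cosh T)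
      + g θ / Real.cosh (-T) * (g θ / Real.cosh (-T)) = 2 / Real.cosh T ^ 2 * g θ ^ 2 := by
    rw [Real.cosh_neg]
    ring
  have hnorm (θ : ℝ) : (∫ s in (-T)..T, Real.cosh s ^ 2 * (g θ / Real.cosh s) ^ 2) =
      2 * T * g θ ^ 2 := by
    have hcancel (s : ℝ) : Real.cosh s ^ 2 * (g θ / Real.cosh s) ^ 2 = g θ ^ 2 := by
      have := hcosh s
      field_simp
    simp only [hcancel, intervalIntegral.integral_const, smul_eq_mul]
    ring
  have hTinv : 1 / T = Real.tanh T := by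
    field_simp
    linarith
  have hsech : 1 / Real.cosh T ^ 2 = 1 - Real.tanh T ^ 2 := by
    have := hcosh T
    rw [Real.tanh_eq_sinh_div_cosh]
    field_simp
    linarith [Real.cosh_sq T]
  have ha2 : a ^ 2 * T = 1 / T * (1 / Real.cosh T ^ 2) := by
    have := hcosh T
    rw [ha]
    field_simp
  unfold indexForm catL2
  simp only [hds, hdθ, hinner, hbdry, hnorm]
  rw [intervalIntegral.integral_add
    (Continuous.intervalIntegrable (by fun_prop) _ _)
    (Continuous.intervalIntegrable (by fun_prop) _ _)]
  simp only [intervalIntegral.integral_const_mul, hgint, hhint]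
  rw [hTinv, hsech] at ha2
  rw [hTinv, show 2 / Real.cosh T ^ 2 = 2 * (1 / Real.cosh T ^ 2) by ring, hsech]
  linear_combination 4 * Real.pi * ha2

/-- For each of `u(s,θ) = cos θ / cosh s` and `u(s,θ) = sin θ / cosh s`,
one has `B(u,u) = -2 N₂(u)`. -/
theorem fraser_schoen_identity_horizontal (T a : ℝ) (hT : 0 < T)
    (hTtanh : T * Real.tanh T = 1) (ha : a = 1 / (T * Real.cosh T)) :
    ∀ u : ℝ → ℝ → ℝ,
      (u = fun s θ => Real.cos θ / Real.cosh s) ∨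
      (u = fun s θ => Real.sin θ / Real.cosh s) →
      indexForm T u u = -2 * catL2 T a u := by
  have hcos : ∫ θ in (0:ℝ)..(2 * Real.pi), Real.cos θ ^ 2 = Real.pi := by
    simp [integral_cos_sq]
  have hsin : ∫ θ in (0:ℝ)..(2 * Real.pi), Real.sin θ ^ 2 = Real.pi := by
    simp [integral_sin_sq]
  rintro u (rfl | rfl)
  · exact indexForm_div_cosh hT hTtanh ha Real.hasDerivAt_cos (by fun_prop) hcos
      (by simp [integral_sin_sq])
  · exact indexForm_div_cosh hT hTtanh ha Real.hasDerivAt_sin (by fun_prop) hsin hcos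
end

section
/- Let v = (v₁,v₂,v₃) ∈ ℝ³ and define φ_v(s,θ) = v₁·cos(θ)/cosh(s) + v₂·sin(θ)/cosh(s) − v₃·tanh(s). Then for every smooth function w on [−T,T]×ℝ, 2π-periodic in θ, satisfying the Jacobi equation ∂²w/∂s² + ∂²w/∂θ² + 2·cosh(s)^{-2}·w = 0 on (−T,T)×ℝ, one has B(φ_v, w) = −2·a²·∫₀^{2π}∫_{−T}^{T} cosh(s)²·φ_v(s,θ)·w(s,θ) ds dθ. -/
/-- The normal component `v·N` of a constant vector `v ∈ ℝ³` along the critical catenoid. -/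
noncomputable def phiV (v₁ v₂ v₃ : ℝ) : ℝ → ℝ → ℝ :=
  fun s θ => v₁ * Real.cos θ / Real.cosh s + v₂ * Real.sin θ / Real.cosh s
    - v₃ * Real.tanh s

open Real Set MeasureTheory intervalIntegral

/-- The Jacobi operator `∂²/∂s² + ∂²/∂θ² + 2 cosh(s)⁻²` of the catenoid. -/
noncomputable def jacobiOp (u : ℝ → ℝ → ℝ) (s θ : ℝ) : ℝ :=
  iteratedDeriv 2 (fun s' => u s' θ) s + iteratedDeriv 2 (fun θ' => u s θ') θ
    + 2 / (Real.cosh s) ^ 2 * u s θ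

/-- The bulk part of the index form. -/
noncomputable def bulkForm (T : ℝ) (u w : ℝ → ℝ → ℝ) : ℝ :=
  ∫ θ in (0:ℝ)..(2 * Real.pi), ∫ s in (-T)..T,
      (deriv (fun s' => u s' θ) s * deriv (fun s' => w s' θ) s
        + deriv (fun θ' => u s θ') θ * deriv (fun θ' => w s θ') θ
        - 2 / (Real.cosh s) ^ 2 * u s θ * w s θ)

section PartialDerivatives

variable {u : ℝ → ℝ → ℝ}

theorem ContDiff.hasDerivAt_fst (hu : ContDiff ℝ (⊤ : ℕ∞) (Function.uncurry u)) (s θ : ℝ) :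
    HasDerivAt (fun s' => u s' θ) (fderiv ℝ (Function.uncurry u) (s, θ) (1, 0)) s := by
  have h := (hu.differentiable (by simp) (s, θ)).hasFDerivAt
  exact h.comp_hasDerivAt s ((hasDerivAt_id s).prodMk (hasDerivAt_const s θ))

theorem ContDiff.hasDerivAt_snd (hu : ContDiff ℝ (⊤ : ℕ∞) (Function.uncurry u)) (s θ : ℝ) :
    HasDerivAt (fun θ' => u s θ') (fderiv ℝ (Function.uncurry u) (s, θ) (0, 1)) θ := by
  have h := (hu.differentiable (by simp) (s, θ)).hasFDerivAt
  exact h.comp_hasDerivAt θ ((hasDerivAt_const θ s).prodMk (hasDerivAt_id θ))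

theorem ContDiff.deriv_fst (hu : ContDiff ℝ (⊤ : ℕ∞) (Function.uncurry u)) :
    ContDiff ℝ (⊤ : ℕ∞) (Function.uncurry fun s θ => deriv (fun s' => u s' θ) s) := by
  have h : (Function.uncurry fun s θ => deriv (fun s' => u s' θ) s) =
      fun p => fderiv ℝ (Function.uncurry u) p (1, 0) := by
    ext ⟨s, θ⟩
    exact (hu.hasDerivAt_fst s θ).deriv
  rw [h]
  exact (hu.fderiv_right (m := (⊤ : ℕ∞)) (by simp)).clm_apply contDiff_const

theorem ContDiff.deriv_snd (hu : ContDiff ℝ (⊤ : ℕ∞) (Function.uncurry u)) :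
    ContDiff ℝ (⊤ : ℕ∞) (Function.uncurry fun s θ => deriv (fun θ' => u s θ') θ) := by
  have h : (Function.uncurry fun s θ => deriv (fun θ' => u s θ') θ) =
      fun p => fderiv ℝ (Function.uncurry u) p (0, 1) := by
    ext ⟨s, θ⟩
    exact (hu.hasDerivAt_snd s θ).deriv
  rw [h]
  exact (hu.fderiv_right (m := (⊤ : ℕ∞)) (by simp)).clm_apply contDiff_const

theorem ContDiff.continuous_jacobiOp (hu : ContDiff ℝ (⊤ : ℕ∞) (Function.uncurry u)) :
    Continuous (Function.uncurry (jacobiOp u)) := by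
  have h₁ := hu.deriv_fst.deriv_fst.continuous
  have h₂ := hu.deriv_snd.deriv_snd.continuous
  have h₃ := hu.continuous
  have h₄ : Continuous fun p : ℝ × ℝ => 2 / (Real.cosh p.1) ^ 2 :=
    continuous_const.div (by fun_prop) fun p => pow_ne_zero 2 (Real.cosh_pos _).ne'
  simp only [Function.uncurry_def, jacobiOp, iteratedDeriv_succ, iteratedDeriv_zero]
  exact (h₁.add h₂).add (h₄.mul h₃)

end PartialDerivatives

section CylinderIntegrals

variable {f g : ℝ → ℝ → ℝ}

theorem intervalIntegrable_fst (hf : Continuous (Function.uncurry f)) (a b θ : ℝ) :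
    IntervalIntegrable (fun s => f s θ) volume a b :=
  (hf.comp (Continuous.prodMk_left θ)).intervalIntegrable _ _

theorem intervalIntegrable_integral_fst (hf : Continuous (Function.uncurry f)) (a b c d : ℝ) :
    IntervalIntegrable (fun θ => ∫ s in a..b, f s θ) volume c d :=
  (continuous_parametric_intervalIntegral_of_continuous' (f := fun θ s => f s θ)
    (hf.comp continuous_swap) _ _).intervalIntegrable _ _

theorem intervalIntegral_intervalIntegral_add (hf : Continuous (Function.uncurry f))
    (hg : Continuous (Function.uncurry g)) (a b c d : ℝ) :
    ∫ θ in c..d, ∫ s in a..b, (f s θ + g s θ) =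
      (∫ θ in c..d, ∫ s in a..b, f s θ) + ∫ θ in c..d, ∫ s in a..b, g s θ := by
  rw [← intervalIntegral.integral_add (intervalIntegrable_integral_fst hf a b c d)
    (intervalIntegrable_integral_fst hg a b c d)]
  exact integral_congr fun θ _ => intervalIntegral.integral_add
    (intervalIntegrable_fst hf a b θ) (intervalIntegrable_fst hg a b θ)

/-- The divergence theorem on a cylinder, for the field with components `f` and `g`. -/
theorem intervalIntegral_intervalIntegral_divergence {f' g' : ℝ → ℝ → ℝ} {a b c d : ℝ}
    (hf : ∀ s θ, HasDerivAt (fun s' => f s' θ) (f' s θ) s)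
    (hg : ∀ s θ, HasDerivAt (fun θ' => g s θ') (g' s θ) θ)
    (hf' : Continuous (Function.uncurry f')) (hg' : Continuous (Function.uncurry g'))
    (hper : ∀ s, g s d = g s c) :
    ∫ θ in c..d, ∫ s in a..b, (f' s θ + g' s θ) = ∫ θ in c..d, (f b θ - f a θ) := by
  have h : ∫ θ in c..d, ∫ s in a..b, g' s θ = 0 := by
    rw [intervalIntegral_intervalIntegral_swap (F := fun θ s => g' s θ)
      (((hg'.comp continuous_swap).continuousOn.integrableOn_compact
        (isCompact_uIcc.prod isCompact_uIcc)).mono_set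
          (prod_mono uIoc_subset_uIcc uIoc_subset_uIcc))]
    refine (integral_congr fun s _ => ?_).trans intervalIntegral.integral_zero
    refine (integral_eq_sub_of_hasDerivAt (fun θ _ => hg s θ)
      ((hg'.comp (Continuous.prodMk_right s)).intervalIntegrable _ _)).trans ?_
    rw [hper, sub_self]
  rw [intervalIntegral_intervalIntegral_add hf' hg', h, add_zero]
  exact integral_congr fun θ _ => integral_eq_sub_of_hasDerivAt (fun s _ => hf s θ)
    (intervalIntegrable_fst hf' a b θ)

end CylinderIntegrals

/-- Integration by parts for the bulk form on the cylinder. -/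
theorem bulkForm_add_integral_jacobiOp {u w : ℝ → ℝ → ℝ} (T : ℝ)
    (hu : ContDiff ℝ (⊤ : ℕ∞) (Function.uncurry u))
    (hw : ContDiff ℝ (⊤ : ℕ∞) (Function.uncurry w))
    (hu_per : ∀ s θ : ℝ, u s (θ + 2 * Real.pi) = u s θ)
    (hw_per : ∀ s θ : ℝ, w s (θ + 2 * Real.pi) = w s θ) :
    bulkForm T u w + (∫ θ in (0:ℝ)..(2 * Real.pi), ∫ s in (-T)..T, jacobiOp u s θ * w s θ) =
      ∫ θ in (0:ℝ)..(2 * Real.pi), (deriv (fun s' => u s' θ) T * w T θ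
        - deriv (fun s' => u s' θ) (-T) * w (-T) θ) := by
  have hus := hu.deriv_fst
  have huθ := hu.deriv_snd
  have hV : Continuous fun p : ℝ × ℝ => 2 / (Real.cosh p.1) ^ 2 :=
    continuous_const.div (by fun_prop) fun p => pow_ne_zero 2 (Real.cosh_pos _).ne'
  have hadd := intervalIntegral_intervalIntegral_add
    (f := fun s θ => deriv (fun s' => u s' θ) s * deriv (fun s' => w s' θ) s
      + deriv (fun θ' => u s θ') θ * deriv (fun θ' => w s θ') θ
      - 2 / (Real.cosh s) ^ 2 * u s θ * w s θ)
    (g := fun s θ => jacobiOp u s θ * w s θ)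
    ((((hus.continuous.mul hw.deriv_fst.continuous).add
      (huθ.continuous.mul hw.deriv_snd.continuous)).sub
        ((hV.mul hu.continuous).mul hw.continuous)).congr fun _ => rfl)
    (hu.continuous_jacobiOp.mul hw.continuous) (-T) T 0 (2 * Real.pi)
  have hdiv := intervalIntegral_intervalIntegral_divergence
    (a := -T) (b := T) (c := 0) (d := 2 * Real.pi)
    (f := fun s θ => deriv (fun s' => u s' θ) s * w s θ)
    (g := fun s θ => deriv (fun θ' => u s θ') θ * w s θ)
    (f' := fun s θ => deriv (fun s' => deriv (fun s' => u s' θ) s') s * w s θ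
      + deriv (fun s' => u s' θ) s * deriv (fun s' => w s' θ) s)
    (g' := fun s θ => deriv (fun θ' => deriv (fun θ' => u s θ') θ') θ * w s θ
      + deriv (fun θ' => u s θ') θ * deriv (fun θ' => w s θ') θ)
    (fun s θ => (hus.hasDerivAt_fst s θ).differentiableAt.hasDerivAt.mul
      (hw.hasDerivAt_fst s θ).differentiableAt.hasDerivAt)
    (fun s θ => (huθ.hasDerivAt_snd s θ).differentiableAt.hasDerivAt.mul
      (hw.hasDerivAt_snd s θ).differentiableAt.hasDerivAt)
    ((hus.deriv_fst.continuous.mul hw.continuous).add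
      (hus.continuous.mul hw.deriv_fst.continuous))
    ((huθ.deriv_snd.continuous.mul hw.continuous).add
      (huθ.continuous.mul hw.deriv_snd.continuous))
    fun s => ?_
  · rw [bulkForm, ← hadd, ← hdiv]
    refine integral_congr fun θ _ => integral_congr fun s _ => ?_
    simp only [jacobiOp, iteratedDeriv_succ, iteratedDeriv_zero]
    ring
  · have h₁ : deriv (fun θ' => u s θ') (0 + 2 * Real.pi) = deriv (fun θ' => u s θ') 0 := by
      rw [← deriv_comp_add_const]
      simp only [hu_per]
    have h₂ := hw_per s 0
    rw [zero_add] at h₁ h₂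
    simp only [h₁, h₂]

theorem bulkForm_comm (T : ℝ) (u w : ℝ → ℝ → ℝ) : bulkForm T u w = bulkForm T w u := by
  refine integral_congr fun θ _ => integral_congr fun s _ => ?_
  ring

/-- The function with radial profiles `A` in the first angular mode and `B` in the zeroth. -/
noncomputable def lowModes (v₁ v₂ : ℝ) (A B : ℝ → ℝ) (s θ : ℝ) : ℝ :=
  A s * (v₁ * Real.cos θ + v₂ * Real.sin θ) + B s

section LowModes

variable {v₁ v₂ : ℝ} {A A' A'' B B' B'' : ℝ → ℝ}

theorem contDiff_lowModes (hA : ContDiff ℝ (⊤ : ℕ∞) A) (hB : ContDiff ℝ (⊤ : ℕ∞) B) :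
    ContDiff ℝ (⊤ : ℕ∞) (Function.uncurry (lowModes v₁ v₂ A B)) := by
  unfold lowModes Function.uncurry
  fun_prop

theorem lowModes_add_two_pi (s θ : ℝ) :
    lowModes v₁ v₂ A B s (θ + 2 * Real.pi) = lowModes v₁ v₂ A B s θ := by
  simp [lowModes]

theorem deriv_lowModes (hA : ∀ s, HasDerivAt A (A' s) s) (hB : ∀ s, HasDerivAt B (B' s) s)
    (s θ : ℝ) : deriv (fun s' => lowModes v₁ v₂ A B s' θ) s = lowModes v₁ v₂ A' B' s θ :=
  (((hA s).mul_const _).add (hB s)).deriv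

theorem jacobiOp_lowModes (hA : ∀ s, HasDerivAt A (A' s) s) (hB : ∀ s, HasDerivAt B (B' s) s)
    (hA' : ∀ s, HasDerivAt A' (A'' s) s) (hB' : ∀ s, HasDerivAt B' (B'' s) s) (s θ : ℝ) :
    jacobiOp (lowModes v₁ v₂ A B) s θ =
      lowModes v₁ v₂ (fun s => A'' s - A s + 2 / (Real.cosh s) ^ 2 * A s)
        (fun s => B'' s + 2 / (Real.cosh s) ^ 2 * B s) s θ := by
  have h₁ (θ : ℝ) : HasDerivAt (fun θ => lowModes v₁ v₂ A B s θ)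
      (A s * (v₁ * -Real.sin θ + v₂ * Real.cos θ)) θ :=
    ((((Real.hasDerivAt_cos θ).const_mul v₁).add
      ((Real.hasDerivAt_sin θ).const_mul v₂)).const_mul (A s)).add_const _
  have h₂ : HasDerivAt (fun θ => A s * (v₁ * -Real.sin θ + v₂ * Real.cos θ))
      (A s * (v₁ * -Real.cos θ + v₂ * -Real.sin θ)) θ :=
    (((Real.hasDerivAt_sin θ).neg.const_mul v₁).add
      ((Real.hasDerivAt_cos θ).const_mul v₂)).const_mul (A s)
  have h₃ : deriv (fun θ => lowModes v₁ v₂ A B s θ) =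
      fun θ => A s * (v₁ * -Real.sin θ + v₂ * Real.cos θ) := funext fun θ => (h₁ θ).deriv
  have h₄ : deriv (fun s => lowModes v₁ v₂ A B s θ) = fun s => lowModes v₁ v₂ A' B' s θ :=
    funext fun s => deriv_lowModes hA hB s θ
  rw [jacobiOp, iteratedDeriv_succ, iteratedDeriv_one, h₄, deriv_lowModes hA' hB',
    iteratedDeriv_succ, iteratedDeriv_one, h₃, h₂.deriv]
  simp only [lowModes]
  ring

end LowModes

section Profiles

theorem Real.hasDerivAt_inv_cosh (s : ℝ) :
    HasDerivAt (fun s => 1 / Real.cosh s) (-Real.sinh s / Real.cosh s ^ 2) s := by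
  simpa only [one_div] using (Real.hasDerivAt_cosh s).fun_inv (Real.cosh_pos s).ne'

theorem hasDerivAt_neg_sinh_div_cosh_sq (s : ℝ) :
    HasDerivAt (fun s => -Real.sinh s / Real.cosh s ^ 2)
      ((Real.sinh s ^ 2 - 1) / Real.cosh s ^ 3) s := by
  have hc := (Real.cosh_pos s).ne'
  refine ((Real.hasDerivAt_sinh s).fun_neg.fun_div ((Real.hasDerivAt_cosh s).fun_pow 2)
    (pow_ne_zero 2 hc)).congr_deriv ?_
  have h := Real.cosh_sq s
  field_simp
  push_cast
  linear_combination -Real.cosh s * h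

theorem hasDerivAt_sinh_div_cosh (s : ℝ) :
    HasDerivAt (fun s => Real.sinh s / Real.cosh s) (1 / Real.cosh s ^ 2) s := by
  have hc := (Real.cosh_pos s).ne'
  refine ((Real.hasDerivAt_sinh s).fun_div (Real.hasDerivAt_cosh s) hc).congr_deriv ?_
  have h := Real.cosh_sq s
  field_simp
  linear_combination h

theorem hasDerivAt_inv_cosh_sq (s : ℝ) :
    HasDerivAt (fun s => 1 / Real.cosh s ^ 2) (-2 * Real.sinh s / Real.cosh s ^ 3) s := by
  have hc := (Real.cosh_pos s).ne'
  refine ((hasDerivAt_const s (1 : ℝ)).fun_div ((Real.hasDerivAt_cosh s).fun_pow 2)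
    (pow_ne_zero 2 hc)).congr_deriv ?_
  field_simp
  push_cast
  ring

variable (m : ℝ)

/-- An even radial profile whose first angular mode is mapped to `cosh` by the Jacobi operator. -/
noncomputable def evenProfile (s : ℝ) : ℝ :=
  ((s ^ 2 - m) * (1 / Real.cosh s) + 2 * s * Real.sinh s - Real.cosh s) / 4

noncomputable def evenProfileDeriv (s : ℝ) : ℝ :=
  (2 * s * (1 / Real.cosh s) + (s ^ 2 - m) * (-Real.sinh s / Real.cosh s ^ 2) + Real.sinh s
    + 2 * s * Real.cosh s) / 4

/-- An odd radial function mapped to `sinh * cosh` by the Jacobi operator. -/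
noncomputable def oddProfile (s : ℝ) : ℝ :=
  (Real.sinh s * Real.cosh s + 2 * s - (s ^ 2 + m) * (Real.sinh s / Real.cosh s)) / 4

noncomputable def oddProfileDeriv (s : ℝ) : ℝ :=
  (Real.cosh s ^ 2 + Real.sinh s ^ 2 + 2 - 2 * s * (Real.sinh s / Real.cosh s)
    - (s ^ 2 + m) * (1 / Real.cosh s ^ 2)) / 4

theorem contDiff_evenProfile : ContDiff ℝ (⊤ : ℕ∞) (evenProfile m) := by
  have h : ∀ s, Real.cosh s ≠ 0 := fun s => (Real.cosh_pos s).ne'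
  unfold evenProfile
  fun_prop (disch := exact h _)

theorem contDiff_oddProfile : ContDiff ℝ (⊤ : ℕ∞) (oddProfile m) := by
  have h : ∀ s, Real.cosh s ≠ 0 := fun s => (Real.cosh_pos s).ne'
  unfold oddProfile
  fun_prop (disch := exact h _)

theorem hasDerivAt_evenProfile (s : ℝ) :
    HasDerivAt (evenProfile m) (evenProfileDeriv m s) s := by
  have h₁ := ((hasDerivAt_pow 2 s).sub_const m).fun_mul (Real.hasDerivAt_inv_cosh s)
  have h₂ := ((hasDerivAt_id' s).const_mul 2).fun_mul (Real.hasDerivAt_sinh s)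
  refine (((h₁.fun_add h₂).fun_sub (Real.hasDerivAt_cosh s)).div_const 4).congr_deriv ?_
  simp only [evenProfileDeriv]
  push_cast
  ring

theorem hasDerivAt_evenProfileDeriv (s : ℝ) :
    HasDerivAt (evenProfileDeriv m)
      (evenProfile m s - 2 / Real.cosh s ^ 2 * evenProfile m s + Real.cosh s) s := by
  have h₁ := ((hasDerivAt_id' s).const_mul 2).fun_mul (Real.hasDerivAt_inv_cosh s)
  have h₂ := ((hasDerivAt_pow 2 s).sub_const m).fun_mul (hasDerivAt_neg_sinh_div_cosh_sq s)
  have h₃ := ((hasDerivAt_id' s).const_mul 2).fun_mul (Real.hasDerivAt_cosh s)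
  refine ((((h₁.fun_add h₂).fun_add (Real.hasDerivAt_sinh s)).fun_add h₃).div_const 4).congr_deriv
    ?_
  have hc := (Real.cosh_pos s).ne'
  have h := Real.sinh_sq s
  simp only [evenProfile]
  push_cast
  rw [h]
  field_simp
  ring

theorem hasDerivAt_oddProfile (s : ℝ) :
    HasDerivAt (oddProfile m) (oddProfileDeriv m s) s := by
  have h₁ := (Real.hasDerivAt_sinh s).fun_mul (Real.hasDerivAt_cosh s)
  have h₂ := (hasDerivAt_id' s).const_mul 2
  have h₃ := ((hasDerivAt_pow 2 s).add_const m).fun_mul (hasDerivAt_sinh_div_cosh s)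
  refine (((h₁.fun_add h₂).fun_sub h₃).div_const 4).congr_deriv ?_
  simp only [oddProfileDeriv]
  push_cast
  ring

theorem hasDerivAt_oddProfileDeriv (s : ℝ) :
    HasDerivAt (oddProfileDeriv m)
      (-(2 / Real.cosh s ^ 2 * oddProfile m s) + Real.sinh s * Real.cosh s) s := by
  have h₁ := ((Real.hasDerivAt_cosh s).fun_pow 2).fun_add ((Real.hasDerivAt_sinh s).fun_pow 2)
  have h₂ := ((hasDerivAt_id' s).const_mul 2).fun_mul (hasDerivAt_sinh_div_cosh s)
  have h₃ := ((hasDerivAt_pow 2 s).add_const m).fun_mul (hasDerivAt_inv_cosh_sq s)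
  refine ((((h₁.add_const 2).fun_sub h₂).fun_sub h₃).div_const 4).congr_deriv ?_
  have hc := (Real.cosh_pos s).ne'
  simp only [oddProfile]
  push_cast
  field_simp
  ring

end Profiles

section NormalComponents

variable (v₁ v₂ v₃ : ℝ)

theorem phiV_eq_lowModes : phiV v₁ v₂ v₃ =
    lowModes v₁ v₂ (fun s => 1 / Real.cosh s) (fun s => -v₃ * (Real.sinh s / Real.cosh s)) := by
  ext s θ
  simp only [phiV, lowModes, Real.tanh_eq_sinh_div_cosh]
  ring

theorem contDiff_phiV : ContDiff ℝ (⊤ : ℕ∞) (Function.uncurry (phiV v₁ v₂ v₃)) := by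
  have h : ∀ s, Real.cosh s ≠ 0 := fun s => (Real.cosh_pos s).ne'
  rw [phiV_eq_lowModes]
  apply contDiff_lowModes <;> fun_prop (disch := exact h _)

theorem phiV_add_two_pi (s θ : ℝ) :
    phiV v₁ v₂ v₃ s (θ + 2 * Real.pi) = phiV v₁ v₂ v₃ s θ := by
  rw [phiV_eq_lowModes, lowModes_add_two_pi]

theorem deriv_phiV (s θ : ℝ) : deriv (fun s' => phiV v₁ v₂ v₃ s' θ) s =
    lowModes v₁ v₂ (fun s => -Real.sinh s / Real.cosh s ^ 2)
      (fun s => -v₃ * (1 / Real.cosh s ^ 2)) s θ := by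
  rw [phiV_eq_lowModes]
  exact deriv_lowModes Real.hasDerivAt_inv_cosh
    (fun s => (hasDerivAt_sinh_div_cosh s).const_mul _) s θ

theorem jacobiOp_phiV (s θ : ℝ) : jacobiOp (phiV v₁ v₂ v₃) s θ = 0 := by
  rw [phiV_eq_lowModes, jacobiOp_lowModes Real.hasDerivAt_inv_cosh
    (fun s => (hasDerivAt_sinh_div_cosh s).const_mul _) hasDerivAt_neg_sinh_div_cosh_sq
    (fun s => (hasDerivAt_inv_cosh_sq s).const_mul _)]
  have hc := (Real.cosh_pos s).ne'
  have h := Real.sinh_sq s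
  simp only [lowModes, h]
  field_simp
  ring

end NormalComponents

/-- A function whose image under the Jacobi operator is `k * cosh² * phiV`; for
`m = T² + cosh² T` it vanishes on the boundary. -/
noncomputable def normalPotential (k m v₁ v₂ v₃ : ℝ) : ℝ → ℝ → ℝ :=
  lowModes v₁ v₂ (fun s => k * evenProfile m s) (fun s => -v₃ * k * oddProfile m s)

section NormalPotential

variable (k m v₁ v₂ v₃ : ℝ)

theorem contDiff_normalPotential :
    ContDiff ℝ (⊤ : ℕ∞) (Function.uncurry (normalPotential k m v₁ v₂ v₃)) :=
  contDiff_lowModes (contDiff_const.mul (contDiff_evenProfile m))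
    (contDiff_const.mul (contDiff_oddProfile m))

theorem deriv_normalPotential (s θ : ℝ) :
    deriv (fun s' => normalPotential k m v₁ v₂ v₃ s' θ) s =
      lowModes v₁ v₂ (fun s => k * evenProfileDeriv m s)
        (fun s => -v₃ * k * oddProfileDeriv m s) s θ :=
  deriv_lowModes (fun s => (hasDerivAt_evenProfile m s).const_mul _)
    (fun s => (hasDerivAt_oddProfile m s).const_mul _) s θ

theorem jacobiOp_normalPotential (s θ : ℝ) :
    jacobiOp (normalPotential k m v₁ v₂ v₃) s θ =
      k * (Real.cosh s ^ 2 * phiV v₁ v₂ v₃ s θ) := by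
  rw [normalPotential, jacobiOp_lowModes (fun s => (hasDerivAt_evenProfile m s).const_mul _)
    (fun s => (hasDerivAt_oddProfile m s).const_mul _)
    (fun s => (hasDerivAt_evenProfileDeriv m s).const_mul _)
    (fun s => (hasDerivAt_oddProfileDeriv m s).const_mul _), phiV_eq_lowModes]
  have hc := (Real.cosh_pos s).ne'
  simp only [lowModes]
  field_simp
  ring

end NormalPotential

section Boundary

variable {T : ℝ}

theorem cosh_eq_mul_sinh (hTtanh : T * Real.tanh T = 1) : Real.cosh T = T * Real.sinh T := by
  have hc := (Real.cosh_pos T).ne'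
  rw [Real.tanh_eq_sinh_div_cosh] at hTtanh
  field_simp at hTtanh
  exact hTtanh.symm

theorem evenProfile_neg (m s : ℝ) : evenProfile m (-s) = evenProfile m s := by
  simp [evenProfile]

theorem oddProfile_neg (m s : ℝ) : oddProfile m (-s) = -oddProfile m s := by
  simp only [oddProfile, Real.sinh_neg, Real.cosh_neg]
  ring

theorem evenProfileDeriv_neg (m s : ℝ) : evenProfileDeriv m (-s) = -evenProfileDeriv m s := by
  simp only [evenProfileDeriv, Real.sinh_neg, Real.cosh_neg]
  ring

theorem oddProfileDeriv_neg (m s : ℝ) : oddProfileDeriv m (-s) = oddProfileDeriv m s := by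
  simp only [oddProfileDeriv, Real.sinh_neg, Real.cosh_neg]
  ring

theorem evenProfile_eq_zero (h : Real.cosh T = T * Real.sinh T) :
    evenProfile (T ^ 2 + Real.cosh T ^ 2) T = 0 := by
  have hc := (Real.cosh_pos T).ne'
  simp only [evenProfile]
  field_simp
  linear_combination -2 * Real.cosh T * h

theorem oddProfile_eq_zero (h : Real.cosh T = T * Real.sinh T) :
    oddProfile (T ^ 2 + Real.cosh T ^ 2) T = 0 := by
  have hc := (Real.cosh_pos T).ne'
  simp only [oddProfile]
  field_simp
  linear_combination 2 * T * h

theorem evenProfileDeriv_boundary (hT : T ≠ 0) (h : Real.cosh T = T * Real.sinh T) :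
    -Real.sinh T / Real.cosh T ^ 2
      + 2 * (1 / (T * Real.cosh T)) ^ 2 * evenProfileDeriv (T ^ 2 + Real.cosh T ^ 2) T =
      1 / T * (1 / Real.cosh T) := by
  have hc := (Real.cosh_pos T).ne'
  have hsq := Real.cosh_sq T
  have hs : Real.sinh T = Real.cosh T / T := by rw [h]; field_simp
  rw [hs] at hsq
  simp only [evenProfileDeriv, hs]
  field_simp at hsq ⊢
  linear_combination (-4) * hsq

theorem oddProfileDeriv_boundary (hT : T ≠ 0) (h : Real.cosh T = T * Real.sinh T) :
    1 / Real.cosh T ^ 2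
      + 2 * (1 / (T * Real.cosh T)) ^ 2 * oddProfileDeriv (T ^ 2 + Real.cosh T ^ 2) T =
      1 / T * (Real.sinh T / Real.cosh T) := by
  have hc := (Real.cosh_pos T).ne'
  have hsq := Real.cosh_sq T
  have hs : Real.sinh T = Real.cosh T / T := by rw [h]; field_simp
  rw [hs] at hsq
  simp only [oddProfileDeriv, hs]
  field_simp at hsq ⊢
  linear_combination (4 * T ^ 2 - 2 * Real.cosh T ^ 2) * hsq

variable (k v₁ v₂ v₃ : ℝ)

theorem normalPotential_eq_zero (h : Real.cosh T = T * Real.sinh T) (θ : ℝ) :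
    normalPotential k (T ^ 2 + Real.cosh T ^ 2) v₁ v₂ v₃ T θ = 0 ∧
      normalPotential k (T ^ 2 + Real.cosh T ^ 2) v₁ v₂ v₃ (-T) θ = 0 := by
  simp [normalPotential, lowModes, evenProfile_neg, oddProfile_neg, evenProfile_eq_zero h,
    oddProfile_eq_zero h]

theorem deriv_phiV_add_deriv_normalPotential (hT : T ≠ 0) (h : Real.cosh T = T * Real.sinh T)
    (θ : ℝ) :
    deriv (fun s => phiV v₁ v₂ v₃ s θ) T
      + deriv (fun s => normalPotential (2 * (1 / (T * Real.cosh T)) ^ 2)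
        (T ^ 2 + Real.cosh T ^ 2) v₁ v₂ v₃ s θ) T = 1 / T * phiV v₁ v₂ v₃ T θ ∧
    deriv (fun s => phiV v₁ v₂ v₃ s θ) (-T)
      + deriv (fun s => normalPotential (2 * (1 / (T * Real.cosh T)) ^ 2)
        (T ^ 2 + Real.cosh T ^ 2) v₁ v₂ v₃ s θ) (-T) = -(1 / T * phiV v₁ v₂ v₃ (-T) θ) := by
  have h₁ := evenProfileDeriv_boundary hT h
  have h₀ := oddProfileDeriv_boundary hT h
  simp only [deriv_phiV, deriv_normalPotential]
  simp only [phiV_eq_lowModes, lowModes, evenProfileDeriv_neg, oddProfileDeriv_neg, Real.sinh_neg, Real.cosh_neg]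
  constructor
  · linear_combination (v₁ * Real.cos θ + v₂ * Real.sin θ) * h₁ - v₃ * h₀
  · linear_combination -(v₁ * Real.cos θ + v₂ * Real.sin θ) * h₁ - v₃ * h₀

end Boundary

/-- The normal components `v^⊥` are eigenfunctions, with eigenvalue `-2`, of the
non-local operator associated to the index form on Jacobi fields: for every smooth,
`2π`-periodic (in `θ`) function `w` satisfying the Jacobi equation on `(-T,T) × ℝ`,
`B(φ_v, w) = -2 a² ∫₀^{2π} ∫_{-T}^T cosh² s · φ_v w ds dθ`. -/
theorem normal_components_eigenfunctions (T a : ℝ) (hT : 0 < T)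
    (hTtanh : T * Real.tanh T = 1) (ha : a = 1 / (T * Real.cosh T))
    (v₁ v₂ v₃ : ℝ) (w : ℝ → ℝ → ℝ)
    (hw_smooth : ContDiff ℝ (⊤ : ℕ∞) (Function.uncurry w))
    (hw_per : ∀ s θ : ℝ, w s (θ + 2 * Real.pi) = w s θ)
    (hw_jacobi : ∀ s ∈ Set.Ioo (-T) T, ∀ θ : ℝ,
      iteratedDeriv 2 (fun s' => w s' θ) s + iteratedDeriv 2 (fun θ' => w s θ') θ
        + 2 / (Real.cosh s) ^ 2 * w s θ = 0) :
    indexForm T (phiV v₁ v₂ v₃) w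
      = -2 * a ^ 2 * ∫ θ in (0:ℝ)..(2 * Real.pi), ∫ s in (-T)..T,
          (Real.cosh s) ^ 2 * phiV v₁ v₂ v₃ s θ * w s θ := by
  subst ha
  obtain ⟨h, h_def⟩ : ∃ h, h = normalPotential (2 * (1 / (T * Real.cosh T)) ^ 2)
    (T ^ 2 + Real.cosh T ^ 2) v₁ v₂ v₃ := ⟨_, rfl⟩
  have hTsinh := cosh_eq_mul_sinh hTtanh
  have hφ := contDiff_phiV v₁ v₂ v₃
  have hh : ContDiff ℝ (⊤ : ℕ∞) (Function.uncurry h) := by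
    rw [h_def]
    exact contDiff_normalPotential _ _ _ _ _
  have hh_per : ∀ s θ : ℝ, h s (θ + 2 * Real.pi) = h s θ := by
    rw [h_def]
    exact lowModes_add_two_pi
  have hh_zero := normalPotential_eq_zero (2 * (1 / (T * Real.cosh T)) ^ 2) v₁ v₂ v₃ hTsinh
  rw [← h_def] at hh_zero
  have hφw := bulkForm_add_integral_jacobiOp T hφ hw_smooth (phiV_add_two_pi v₁ v₂ v₃) hw_per
  have hhw := bulkForm_add_integral_jacobiOp T hh hw_smooth hh_per hw_per
  have hwh := bulkForm_add_integral_jacobiOp T hw_smooth hh hw_per hh_per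
  have hw_zero : (∫ θ in (0:ℝ)..(2 * Real.pi), ∫ s in (-T)..T, jacobiOp w s θ * h s θ) = 0 := by
    refine (integral_congr fun θ _ => ?_).trans intervalIntegral.integral_zero
    refine (integral_congr_Ioo_of_le (g := fun _ => (0 : ℝ)) (by linarith) fun s hs => ?_).trans
      intervalIntegral.integral_zero
    simp only [jacobiOp, hw_jacobi s hs θ, zero_mul]
  have hbulk : bulkForm T h w = 0 := by
    rw [bulkForm_comm]
    simpa [hh_zero, hw_zero] using hwh
  simp only [jacobiOp_phiV, zero_mul, intervalIntegral.integral_zero, add_zero] at hφw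
  have hJh (s θ : ℝ) : jacobiOp h s θ =
      2 * (1 / (T * Real.cosh T)) ^ 2 * (Real.cosh s ^ 2 * phiV v₁ v₂ v₃ s θ) := by
    rw [h_def, jacobiOp_normalPotential]
  simp only [hbulk, zero_add, hJh, mul_assoc, intervalIntegral.integral_const_mul] at hhw
  have boundary {u : ℝ → ℝ → ℝ} (hu : ContDiff ℝ (⊤ : ℕ∞) (Function.uncurry u)) :
      IntervalIntegrable (fun θ => deriv (fun s => u s θ) T * w T θ
        - deriv (fun s => u s θ) (-T) * w (-T) θ) volume 0 (2 * Real.pi) := by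
    have hc := hu.deriv_fst.continuous.mul hw_smooth.continuous
    exact ((hc.comp (Continuous.prodMk_right T)).sub
      (hc.comp (Continuous.prodMk_right (-T)))).intervalIntegrable _ _
  have hsum := intervalIntegral.integral_add (boundary hφ) (boundary hh)
  have hrobin : (∫ θ in (0:ℝ)..(2 * Real.pi),
      ((deriv (fun s => phiV v₁ v₂ v₃ s θ) T * w T θ
        - deriv (fun s => phiV v₁ v₂ v₃ s θ) (-T) * w (-T) θ)
        + (deriv (fun s => h s θ) T * w T θ - deriv (fun s => h s θ) (-T) * w (-T) θ))) =
      (1 / T) * ∫ θ in (0:ℝ)..(2 * Real.pi),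
        (phiV v₁ v₂ v₃ T θ * w T θ + phiV v₁ v₂ v₃ (-T) θ * w (-T) θ) := by
    rw [← intervalIntegral.integral_const_mul]
    refine integral_congr fun θ _ => ?_
    obtain ⟨h₁, h₂⟩ := deriv_phiV_add_deriv_normalPotential v₁ v₂ v₃ hT.ne' hTsinh θ
    simp only [h_def]
    linear_combination w T θ * h₁ - w (-T) θ * h₂
  change bulkForm T (phiV v₁ v₂ v₃) w - _ = _
  simp only [mul_assoc]
  rw [← hrobin, hsum, hφw]
  linear_combination hhw
end

section
/- There exists a smooth function w : [−T,T] → ℝ, not identically zero, such that ∫_{−T}^{T}(w'(s)² + w(s)² − 2·cosh(s)^{-2}·w(s)²) ds − (1/T)·(w(T)² + w(−T)²) < −2·a²·∫_{−T}^{T} cosh(s)²·w(s)² ds. -/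
/-- An antiderivative of `1 - 2 / cosh²` is `s - 2 tanh s`. -/
theorem integral_one_sub_two_div_cosh_sq (T : ℝ) :
    ∫ s in (-T)..T, (1 - 2 / Real.cosh s ^ 2) = 2 * T - 4 * (Real.sinh T / Real.cosh T) := by
  have hderiv : ∀ x ∈ Set.uIcc (-T) T,
      HasDerivAt (fun s : ℝ => s - 2 * (Real.sinh s / Real.cosh s))
        (1 - 2 / Real.cosh x ^ 2) x := by
    intro x _
    have hc := (Real.cosh_pos x).ne'
    refine ((hasDerivAt_id x).sub
      (((Real.hasDerivAt_sinh x).div (Real.hasDerivAt_cosh x) hc).const_mul 2)).congr_deriv ?_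
    have := Real.cosh_sq x
    field_simp
    linarith
  have hcont : Continuous fun s : ℝ => 1 - 2 / Real.cosh s ^ 2 :=
    continuous_const.sub (continuous_const.div (Real.continuous_cosh.pow 2)
      fun x => pow_ne_zero 2 (Real.cosh_pos x).ne')
  rw [intervalIntegral.integral_eq_sub_of_hasDerivAt hderiv (hcont.intervalIntegrable _ _)]
  simp only [Real.sinh_neg, Real.cosh_neg]
  ring

theorem integral_cosh_sq_symm (T : ℝ) :
    ∫ s in (-T)..T, Real.cosh s ^ 2 = T + Real.sinh T * Real.cosh T := by
  have hderiv : ∀ x ∈ Set.uIcc (-T) T,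
      HasDerivAt (fun s : ℝ => (s + Real.sinh s * Real.cosh s) / 2) (Real.cosh x ^ 2) x := by
    intro x _
    refine (((hasDerivAt_id x).add
      ((Real.hasDerivAt_sinh x).mul (Real.hasDerivAt_cosh x))).div_const 2).congr_deriv ?_
    have := Real.cosh_sq x
    linarith
  rw [intervalIntegral.integral_eq_sub_of_hasDerivAt hderiv
    ((Real.continuous_cosh.pow 2).intervalIntegrable _ _)]
  simp only [Real.sinh_neg, Real.cosh_neg]
  ring


/-- The first eigenvalue of the Robin problem for the radial operator `L₁` on the
critical catenoid is strictly less than `-2`: there exists a smooth, not identically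
zero function `w : [-T,T] → ℝ` with
`∫_{-T}^T (w'² + w² - 2 cosh⁻² s · w²) ds - (1/T)(w(T)² + w(-T)²)
  < -2 a² ∫_{-T}^T cosh² s · w² ds`. -/
theorem first_L1_eigenvalue_below_minus_two (T a : ℝ) (hT : 0 < T)
    (hTtanh : T * Real.tanh T = 1) (ha : a = 1 / (T * Real.cosh T)) :
    ∃ w : ℝ → ℝ,
      ContDiff ℝ (⊤ : ℕ∞) w ∧
      (∃ s ∈ Set.Icc (-T) T, w s ≠ 0) ∧
      (∫ s in (-T)..T,
          ((deriv w s) ^ 2 + (w s) ^ 2 - 2 / (Real.cosh s) ^ 2 * (w s) ^ 2))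
        - (1 / T) * ((w T) ^ 2 + (w (-T)) ^ 2)
        < -2 * a ^ 2 * ∫ s in (-T)..T, (Real.cosh s) ^ 2 * (w s) ^ 2 := by
  have hc := Real.cosh_pos T
  have hsinh : T * Real.sinh T = Real.cosh T := by
    rw [Real.tanh_eq_sinh_div_cosh] at hTtanh
    field_simp at hTtanh
    exact hTtanh
  have hsq := Real.cosh_sq T
  have hle : T ≤ Real.sinh T := Real.self_le_sinh_iff.2 hT.le
  have hs : 0 < Real.sinh T := hT.trans_le hle
  have hT2 : T ^ 2 < 2 := by
    by_contra! h
    rw [← hsinh] at hsq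
    nlinarith [mul_nonneg (sub_nonneg.2 h) (sq_nonneg (Real.sinh T))]
  refine ⟨fun _ => 1, contDiff_const, ⟨0, ⟨by linarith, hT.le⟩, one_ne_zero⟩, ?_⟩
  have hrhs : -2 * a ^ 2 * (T + Real.sinh T * Real.cosh T) = -2 / T := by
    rw [ha, ← hsinh]
    rw [← hsinh] at hsq
    field_simp
    linarith
  have hquot : Real.sinh T / Real.cosh T = 1 / T := by
    rw [← hsinh]
    field_simp
  simp only [deriv_const, one_pow, mul_one, ne_eq, OfNat.ofNat_ne_zero, not_false_eq_true,
    zero_pow, zero_add]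
  rw [integral_one_sub_two_div_cosh_sq, integral_cosh_sq_symm, hrhs, hquot, ← sub_pos]
  have : -2 / T - (2 * T - 4 * (1 / T) - 1 / T * (1 + 1)) = 2 * (2 - T ^ 2) / T := by
    field_simp
    ring
  rw [this]
  exact div_pos (by linarith) hT
end

section
/- Every smooth function w on [−T,T]×ℝ, 2π-periodic in θ, satisfying the Jacobi equation ∂²w/∂s² + ∂²w/∂θ² + 2·cosh(s)^{-2}·w = 0 on (−T,T)×ℝ, satisfies the inequality B(w,w) ≥ −2·N₂(w). -/
open Real Set intervalIntegral

lemma norm_sq_fourierCoeffOn_zero (f : ℝ → ℝ) :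
    ‖fourierCoeffOn two_pi_pos (fun x => (f x : ℂ)) 0‖ ^ 2
      = (∫ x in (0:ℝ)..(2 * π), f x) ^ 2 / (2 * π) ^ 2 := by
  rw [fourierCoeffOn_eq_integral]
  simp [mul_pow, abs_of_pos pi_pos, intervalIntegral.integral_ofReal]
  field_simp

lemma norm_sq_fourierCoeffOn_of_sq_eq_one {f : ℝ → ℝ} (hf : Continuous f) {n : ℤ}
    (hn : n = 1 ∨ n = -1) :
    ‖fourierCoeffOn two_pi_pos (fun x => (f x : ℂ)) n‖ ^ 2
      = ((∫ x in (0:ℝ)..(2 * π), f x * cos x) ^ 2 + (∫ x in (0:ℝ)..(2 * π), f x * sin x) ^ 2)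
        / (2 * π) ^ 2 := by
  have hn2 : (n : ℝ) ^ 2 = 1 := by rcases hn with rfl | rfl <;> norm_num
  have key : ∀ x : ℝ, fourier (-n) (x : AddCircle (2 * π - 0)) • (f x : ℂ)
      = ((f x * cos x : ℝ) : ℂ) - (n * Complex.I) * ((f x * sin x : ℝ) : ℂ) := by
    intro x
    rw [fourier_coe_apply, smul_eq_mul]
    have h1 : 2 * (π : ℂ) * Complex.I * ((-n : ℤ) : ℂ) * x / ((2 * π - 0 : ℝ) : ℂ)
        = ((-n * x : ℝ) : ℂ) * Complex.I := by
      have : (π : ℂ) ≠ 0 := by exact_mod_cast pi_ne_zero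
      push_cast
      rw [sub_zero]
      field_simp
    rw [h1, Complex.exp_mul_I, ← Complex.ofReal_cos, ← Complex.ofReal_sin]
    rcases hn with rfl | rfl <;> simp <;> ring
  rw [fourierCoeffOn_eq_integral]
  simp_rw [key]
  have hi1 : IntervalIntegrable (fun x => ((f x * cos x : ℝ) : ℂ)) MeasureTheory.volume 0 (2 * π) :=
    Continuous.intervalIntegrable (by fun_prop) _ _
  have hi2 : IntervalIntegrable (fun x => (n * Complex.I) * ((f x * sin x : ℝ) : ℂ))
      MeasureTheory.volume 0 (2 * π) := Continuous.intervalIntegrable (by fun_prop) _ _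
  rw [integral_sub hi1 hi2, integral_const_mul, integral_ofReal, integral_ofReal, norm_smul,
    mul_pow, ← Complex.normSq_eq_norm_sq, Complex.normSq_apply]
  simp only [Complex.sub_re, Complex.sub_im, Complex.mul_re, Complex.mul_im, Complex.ofReal_re,
    Complex.ofReal_im, Complex.intCast_re, Complex.intCast_im, Complex.I_re, Complex.I_im,
    norm_eq_abs, sq_abs]
  field_simp
  linear_combination (4 * π ^ 2 * (∫ x in (0:ℝ)..(2 * π), f x * sin x) ^ 2) * hn2

lemma hasSum_sq_fourierCoeffOn_ofReal {f : ℝ → ℝ} (hf : Continuous f) :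
    HasSum (fun n => ‖fourierCoeffOn two_pi_pos (fun x => (f x : ℂ)) n‖ ^ 2)
      ((2 * π)⁻¹ * ∫ x in (0:ℝ)..(2 * π), f x ^ 2) := by
  have hc : Continuous (fun x => (f x : ℂ)) := by fun_prop
  have h := hasSum_sq_fourierCoeffOn (f := fun x => (f x : ℂ)) two_pi_pos (by
    rw [MeasureTheory.memLp_two_iff_integrable_sq_norm hc.aestronglyMeasurable]
    exact Continuous.integrableOn_Ioc (by fun_prop))
  simpa using h

/-- Bessel's inequality for the Fourier modes `0` and `1`. -/
lemma bessel_two_modes {f : ℝ → ℝ} (hf : Continuous f) :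
    (∫ x in (0:ℝ)..(2 * π), f x) ^ 2 + 2 * ((∫ x in (0:ℝ)..(2 * π), f x * cos x) ^ 2
        + (∫ x in (0:ℝ)..(2 * π), f x * sin x) ^ 2)
      ≤ 2 * π * ∫ x in (0:ℝ)..(2 * π), f x ^ 2 := by
  have h := sum_le_hasSum ({-1, 0, 1} : Finset ℤ) (fun i _ => by positivity)
    (hasSum_sq_fourierCoeffOn_ofReal hf)
  rw [Finset.sum_insert (by decide), Finset.sum_insert (by decide), Finset.sum_singleton,
    norm_sq_fourierCoeffOn_zero, norm_sq_fourierCoeffOn_of_sq_eq_one hf (Or.inl rfl),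
    norm_sq_fourierCoeffOn_of_sq_eq_one hf (Or.inr rfl)] at h
  have := pi_pos
  field_simp at h
  linarith

/-- Wirtinger's inequality for periodic functions, with defect on the Fourier modes `0`, `1`. -/
lemma wirtinger_two_modes {f f' : ℝ → ℝ} (hf : ∀ x, HasDerivAt f (f' x) x) (hf' : Continuous f')
    (hper : f (2 * π) = f 0) :
    8 * π * (∫ x in (0:ℝ)..(2 * π), f x ^ 2)
      ≤ 2 * π * (∫ x in (0:ℝ)..(2 * π), f' x ^ 2) + 4 * (∫ x in (0:ℝ)..(2 * π), f x) ^ 2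
        + 6 * ((∫ x in (0:ℝ)..(2 * π), f x * cos x) ^ 2
          + (∫ x in (0:ℝ)..(2 * π), f x * sin x) ^ 2) := by
  have hfc : Continuous f := continuous_iff_continuousAt.2 fun x => (hf x).continuousAt
  have hcoeff : ∀ n : ℤ, (n : ℝ) ^ 2 * ‖fourierCoeffOn two_pi_pos (fun x => (f x : ℂ)) n‖ ^ 2
      ≤ ‖fourierCoeffOn two_pi_pos (fun x => (f' x : ℂ)) n‖ ^ 2 := by
    intro n
    rcases eq_or_ne n 0 with rfl | hn
    · simp
    · rw [fourierCoeffOn_of_hasDerivAt two_pi_pos hn (f' := fun x => (f' x : ℂ))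
        (fun x _ => (hf x).ofReal_comp)
        (Continuous.intervalIntegrable (by fun_prop) _ _), hper]
      have hn' : (n : ℝ) ≠ 0 := by exact_mod_cast hn
      have hp := pi_ne_zero
      simp [mul_pow, abs_of_pos pi_pos]
      field_simp
      rfl
  have h := sum_le_hasSum ({-1, 0, 1} : Finset ℤ) ?_
    ((hasSum_sq_fourierCoeffOn_ofReal hf').sub ((hasSum_sq_fourierCoeffOn_ofReal hfc).mul_left 4))
  · rw [Finset.sum_insert (by decide), Finset.sum_insert (by decide), Finset.sum_singleton,
      norm_sq_fourierCoeffOn_zero f, norm_sq_fourierCoeffOn_of_sq_eq_one hfc (Or.inl rfl),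
      norm_sq_fourierCoeffOn_of_sq_eq_one hfc (Or.inr rfl)] at h
    have h1 := hcoeff 1
    have h2 := hcoeff (-1)
    have h0 : 0 ≤ ‖fourierCoeffOn two_pi_pos (fun x => (f' x : ℂ)) 0‖ ^ 2 := by positivity
    rw [norm_sq_fourierCoeffOn_of_sq_eq_one hfc (Or.inl rfl)] at h1
    rw [norm_sq_fourierCoeffOn_of_sq_eq_one hfc (Or.inr rfl)] at h2
    have := pi_pos
    push_cast at h1 h2
    set P := ((∫ x in (0:ℝ)..(2 * π), f x * cos x) ^ 2
      + (∫ x in (0:ℝ)..(2 * π), f x * sin x) ^ 2)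
    have h3 : -(4 * ((∫ x in (0:ℝ)..(2 * π), f x) ^ 2 / (2 * π) ^ 2)) - 6 * (P / (2 * π) ^ 2)
      ≤ (2 * π)⁻¹ * (∫ x in (0:ℝ)..(2 * π), f' x ^ 2)
        - 4 * ((2 * π)⁻¹ * ∫ x in (0:ℝ)..(2 * π), f x ^ 2) := by linarith
    field_simp at h3
    linarith
  · intro n hn
    have h4 : (4 : ℝ) ≤ (n : ℝ) ^ 2 := by
      simp only [Finset.mem_insert, Finset.mem_singleton, not_or] at hn
      have : (2 : ℤ) ≤ |n| := by grind
      have : (2 : ℝ) ≤ |(n : ℝ)| := by exact_mod_cast this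
      rw [← sq_abs]; nlinarith
    nlinarith [hcoeff n, sq_nonneg ‖fourierCoeffOn two_pi_pos (fun x => (f x : ℂ)) n‖]

lemma ContDiff.exists_partial_fst {F : ℝ → ℝ → ℝ} (hF : ContDiff ℝ (⊤ : ℕ∞) (Function.uncurry F)) :
    ∃ G : ℝ → ℝ → ℝ, ContDiff ℝ (⊤ : ℕ∞) (Function.uncurry G) ∧
      ∀ s θ, HasDerivAt (fun s' => F s' θ) (G s θ) s := by
  refine ⟨fun s θ => fderiv ℝ (Function.uncurry F) (s, θ) (1, 0), ?_, fun s θ => ?_⟩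
  · exact (hF.fderiv_right (m := (⊤ : ℕ∞)) (by simp)).clm_apply contDiff_const
  · have h := (hF.differentiable (by simp) (s, θ)).hasFDerivAt
    exact h.comp_hasDerivAt (f := fun s' : ℝ => (s', θ)) s
      ((hasDerivAt_id s).prodMk (hasDerivAt_const s θ))

lemma ContDiff.exists_partial_snd {F : ℝ → ℝ → ℝ} (hF : ContDiff ℝ (⊤ : ℕ∞) (Function.uncurry F)) :
    ∃ G : ℝ → ℝ → ℝ, ContDiff ℝ (⊤ : ℕ∞) (Function.uncurry G) ∧
      ∀ s θ, HasDerivAt (fun θ' => F s θ') (G s θ) θ := by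
  refine ⟨fun s θ => fderiv ℝ (Function.uncurry F) (s, θ) (0, 1), ?_, fun s θ => ?_⟩
  · exact (hF.fderiv_right (m := (⊤ : ℕ∞)) (by simp)).clm_apply contDiff_const
  · have h := (hF.differentiable (by simp) (s, θ)).hasFDerivAt
    exact h.comp_hasDerivAt (f := fun θ' : ℝ => (s, θ')) θ
      ((hasDerivAt_const θ s).prodMk (hasDerivAt_id θ))

lemma hasDerivAt_intervalIntegral_of_continuous {F G : ℝ → ℝ → ℝ}
    (hF : Continuous (Function.uncurry F)) (hG : Continuous (Function.uncurry G))
    (hFG : ∀ s θ, HasDerivAt (fun s' => F s' θ) (G s θ) s) (a b s : ℝ) :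
    HasDerivAt (fun s => ∫ θ in a..b, F s θ) (∫ θ in a..b, G s θ) s := by
  obtain ⟨C, hC⟩ := ((isCompact_Icc (a := s - 1) (b := s + 1)).prod
    (isCompact_uIcc (a := a) (b := b))).exists_bound_of_continuousOn hG.continuousOn
  have hF1 : ∀ s, Continuous (F s) := fun s => hF.uncurry_left s
  have hG1 : ∀ s, Continuous (G s) := fun s => hG.uncurry_left s
  refine (hasDerivAt_integral_of_dominated_loc_of_deriv_le (bound := fun _ => C)
    (Icc_mem_nhds (sub_one_lt s) (lt_add_one s))
    (.of_forall fun x => (hF1 x).aestronglyMeasurable) ((hF1 s).intervalIntegrable _ _)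
    (hG1 s).aestronglyMeasurable (.of_forall fun t ht x hx => ?_) intervalIntegrable_const
    (.of_forall fun t _ x _ => hFG x t)).2
  exact hC (x, t) ⟨hx, uIoc_subset_uIcc ht⟩

lemma hasDerivAt_real_tanh (x : ℝ) : HasDerivAt tanh (1 / cosh x ^ 2) x := by
  have h := (hasDerivAt_sinh x).div (hasDerivAt_cosh x) (cosh_pos x).ne'
  have e : tanh = sinh / cosh := by ext y; simp [tanh_eq_sinh_div_cosh]
  rw [e]
  refine h.congr_deriv ?_
  rw [← sq, ← sq, cosh_sq x]
  ring

lemma continuous_real_tanh : Continuous tanh :=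
  continuous_iff_continuousAt.2 fun x => (hasDerivAt_real_tanh x).continuousAt

lemma wronskian_eq {T : ℝ} {f f' f'' g g' g'' : ℝ → ℝ}
    (hf : ∀ s, HasDerivAt f (f' s) s) (hf' : ∀ s, HasDerivAt f' (f'' s) s)
    (hg : ∀ s, HasDerivAt g (g' s) s) (hg' : ∀ s, HasDerivAt g' (g'' s) s)
    (h : ∀ s ∈ Ioo (-T) T, f'' s * g s = f s * g'' s) {s : ℝ} (hs : s ∈ Icc (-T) T) :
    f' s * g s - f s * g' s = f' (-T) * g (-T) - f (-T) * g' (-T) := by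
  have hd : ∀ x, HasDerivAt (fun x => f' x * g x - f x * g' x)
      (f'' x * g x + f' x * g' x - (f' x * g' x + f x * g'' x)) x := fun x =>
    ((hf' x).mul (hg x)).sub ((hf x).mul (hg' x))
  have := integral_eq_sub_of_hasDerivAt_of_le (f' := fun _ => (0 : ℝ)) hs.1
    (fun x _ => (hd x).continuousAt.continuousWithinAt)
    (fun x hx => (hd x).congr_deriv (by
      linear_combination h x ⟨hx.1, hx.2.trans_le hs.2⟩)) intervalIntegrable_const
  simp only [integral_zero] at this
  linarith

/-- The energy density of a Fourier mode, after absorbing the boundary terms. -/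
noncomputable def modeEnergy (a k : ℝ) (A A' : ℝ → ℝ) (s : ℝ) : ℝ :=
  (A' s - tanh s * A s) ^ 2 + (k - 1 - 2 / cosh s ^ 2) * A s ^ 2 + 2 * a ^ 2 * (cosh s ^ 2 * A s ^ 2)

lemma continuous_modeEnergy (a k : ℝ) {A A' : ℝ → ℝ} (hA : Continuous A) (hA' : Continuous A') :
    Continuous (modeEnergy a k A A') := by
  have := continuous_real_tanh
  unfold modeEnergy
  have hc : ∀ s, cosh s ^ 2 ≠ 0 := fun s => (pow_pos (cosh_pos s) 2).ne'
  fun_prop (disch := exact hc _)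

lemma integral_modeEnergy_ge {T : ℝ} (hT : 0 < T) (a k : ℝ) {A A' A'' K K' : ℝ → ℝ}
    (hA : ∀ s, HasDerivAt A (A' s) s) (hA' : ∀ s, HasDerivAt A' (A'' s) s)
    (hode : ∀ s ∈ Ioo (-T) T, A'' s = (k - 2 / cosh s ^ 2) * A s)
    (hK : ∀ s, HasDerivAt K (K' s) s) (hK'c : Continuous K')
    (hle : ∀ s ∈ Icc (-T) T, K' s ≤ cosh s ^ 2 * A s ^ 2) :
    (A T * A' T - tanh T * A T ^ 2) - (A (-T) * A' (-T) + tanh T * A (-T) ^ 2)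
      + 2 * a ^ 2 * (K T - K (-T)) ≤ ∫ s in (-T)..T, modeEnergy a k A A' s := by
  have hAc : Continuous A := continuous_iff_continuousAt.2 fun x => (hA x).continuousAt
  have hA'c : Continuous A' := continuous_iff_continuousAt.2 fun x => (hA' x).continuousAt
  have hTT : -T ≤ T := by linarith
  have hG : ∀ s, HasDerivAt (fun s => A s * A' s - tanh s * A s ^ 2 + 2 * a ^ 2 * K s)
      (A' s * A' s + A s * A'' s - (1 / cosh s ^ 2 * A s ^ 2 + tanh s * (2 * A s * A' s))
        + 2 * a ^ 2 * K' s) s := fun s => by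
    refine ((((hA s).mul (hA' s)).sub ((hasDerivAt_real_tanh s).mul ((hA s).pow 2))).add
      ((hK s).const_mul (2 * a ^ 2))).congr_deriv ?_
    simp
  have htc := continuous_real_tanh
  have hc : ∀ s, cosh s ^ 2 ≠ 0 := fun s => (pow_pos (cosh_pos s) 2).ne'
  have hcont : Continuous fun s => (A' s - tanh s * A s) ^ 2
      + (k - 1 - 2 / cosh s ^ 2) * A s ^ 2 + 2 * a ^ 2 * K' s := by
    fun_prop (disch := exact hc _)
  have hftc := integral_eq_sub_of_hasDerivAt_of_le hTT
    (fun x _ => (hG x).continuousAt.continuousWithinAt)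
    (fun x hx => (hG x).congr_deriv (g' := (A' x - tanh x * A x) ^ 2
      + (k - 1 - 2 / cosh x ^ 2) * A x ^ 2 + 2 * a ^ 2 * K' x) (by
        rw [hode x hx, tanh_eq_sinh_div_cosh]
        have := (cosh_pos x).ne'
        field_simp
        linear_combination (A x ^ 2) * cosh_sq x)) (hcont.intervalIntegrable _ _)
  have hmono := integral_mono_on hTT (hcont.intervalIntegrable (μ := MeasureTheory.volume) _ _)
    ((continuous_modeEnergy a k hAc hA'c).intervalIntegrable _ _) (fun x hx => by
      unfold modeEnergy
      have := mul_le_mul_of_nonneg_left (hle x hx) (by positivity : 0 ≤ 2 * a ^ 2)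
      linarith)
  rw [hftc, tanh_neg] at hmono
  linarith

lemma integral_modeEnergy_zero_nonneg {T a : ℝ} (hT : 0 < T) (hTtanh : T * tanh T = 1)
    (ha : a = 1 / (T * cosh T)) {A A' A'' : ℝ → ℝ}
    (hA : ∀ s, HasDerivAt A (A' s) s) (hA' : ∀ s, HasDerivAt A' (A'' s) s)
    (hode : ∀ s ∈ Ioo (-T) T, A'' s = -(2 / cosh s ^ 2) * A s) :
    0 ≤ ∫ s in (-T)..T, modeEnergy a 0 A A' s := by
  have hc : ∀ s, cosh s ≠ 0 := fun s => (cosh_pos s).ne'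
  have hsech : ∀ s, HasDerivAt (fun s => 1 / cosh s ^ 2) (-(2 * tanh s / cosh s ^ 2)) s := fun s => by
    refine ((hasDerivAt_const s (1 : ℝ)).div ((hasDerivAt_cosh s).pow 2)
      (pow_ne_zero 2 (hc s))).congr_deriv ?_
    have := hc s
    simp [tanh_eq_sinh_div_cosh]
    field_simp
  have hh : ∀ s, HasDerivAt (fun s => 1 - s * tanh s) (-(tanh s + s * (1 / cosh s ^ 2))) s :=
    fun s => (((hasDerivAt_id s).mul (hasDerivAt_real_tanh s)).const_sub 1).congr_deriv (by simp)
  have hh' : ∀ s, HasDerivAt (fun s => -(tanh s + s * (1 / cosh s ^ 2)))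
      (-(1 / cosh s ^ 2 + (1 / cosh s ^ 2 + s * -(2 * tanh s / cosh s ^ 2)))) s :=
    fun s => (((hasDerivAt_real_tanh s).add ((hasDerivAt_id s).mul (hsech s))).neg).congr_deriv
      (by simp)
  have hW1 := fun s (hs : s ∈ Icc (-T) T) =>
    wronskian_eq hA hA' hh hh' (fun x hx => by rw [hode x hx]; ring) hs
  have hW2 := fun s (hs : s ∈ Icc (-T) T) =>
    wronskian_eq hA hA' hasDerivAt_real_tanh hsech (fun x hx => by rw [hode x hx]; ring) hs
  set α := A' (-T) * (1 - -T * tanh (-T)) - A (-T) * -(tanh (-T) + -T * (1 / cosh (-T) ^ 2))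
  set β := -(A' (-T) * tanh (-T) - A (-T) * (1 / cosh (-T) ^ 2)) with hβ
  have hq : ∀ s, tanh s ^ 2 = 1 - 1 / cosh s ^ 2 := fun s => by
    have := hc s
    rw [tanh_eq_sinh_div_cosh]
    field_simp
    linear_combination -cosh_sq s
  have hAs : ∀ s ∈ Icc (-T) T, A s = α * tanh s + β * (1 - s * tanh s) := fun s hs => by
    have h2 : β = -(A' s * tanh s - A s * (1 / cosh s ^ 2)) := by rw [hW2 s hs]
    rw [← hW1 s hs, h2]
    linear_combination (-A s) * hq s
  have hAs' : ∀ s ∈ Icc (-T) T,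
      A' s = α * (1 / cosh s ^ 2) - β * (tanh s + s * (1 / cosh s ^ 2)) := fun s hs => by
    have h2 : β = -(A' s * tanh s - A s * (1 / cosh s ^ 2)) := by rw [hW2 s hs]
    rw [← hW1 s hs, h2]
    linear_combination (-A' s) * hq s
  have hK : ∀ s, HasDerivAt (fun s => α ^ 2 * ((sinh s * cosh s - s) / 2)
      + 2 * α * β * (sinh s ^ 2 / 2 - (s * (sinh s * cosh s - s) / 2 - sinh s ^ 2 / 4 + s ^ 2 / 4)))
      (α ^ 2 * sinh s ^ 2 + 2 * α * β * (sinh s * (cosh s - s * sinh s))) s := fun s => by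
    have hs := hasDerivAt_sinh s
    have hid := hasDerivAt_id s
    have hsc := (hs.mul (hasDerivAt_cosh s)).sub hid
    have hs2 := hs.pow 2
    refine (((hsc.div_const 2).const_mul (α ^ 2)).add (((hs2.div_const 2).sub
      ((((hid.mul hsc).div_const 2).sub (hs2.div_const 4)).add
        ((hid.pow 2).div_const 4))).const_mul (2 * α * β))).congr_deriv ?_
    simp
    linear_combination (α ^ 2 / 2 - α * β * s) * cosh_sq s
  have hmain := integral_modeEnergy_ge hT a 0 hA hA' (fun s hs => by rw [hode s hs]; ring) hK
    (by fun_prop) (fun s hs => by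
      rw [hAs s hs, tanh_eq_sinh_div_cosh]
      have := hc s
      have e : cosh s ^ 2 * (α * (sinh s / cosh s) + β * (1 - s * (sinh s / cosh s))) ^ 2
        = (α * sinh s + β * (cosh s - s * sinh s)) ^ 2 := by field_simp
      rw [e]
      nlinarith [sq_nonneg (β * (cosh s - s * sinh s))])
  refine le_trans (le_of_eq ?_) hmain
  have hTm : T ∈ Icc (-T) T := ⟨by linarith, le_rfl⟩
  have hTm' : -T ∈ Icc (-T) T := ⟨le_rfl, by linarith⟩
  rw [hAs T hTm, hAs' T hTm, hAs (-T) hTm', hAs' (-T) hTm']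
  simp only [tanh_neg, cosh_neg, sinh_neg]
  have e1 : 1 - T * tanh T = 0 := by linarith
  have e2 : 1 - -T * -tanh T = 0 := by linarith
  rw [e1, e2, ha]
  have hT0 := hT.ne'
  have hs : sinh T = cosh T / T := by
    rw [tanh_eq_sinh_div_cosh] at hTtanh
    have := hc T
    field_simp at hTtanh ⊢
    linarith
  have ht : tanh T = 1 / T := by field_simp; linarith
  rw [hs, ht]
  have := hc T
  field_simp
  ring

lemma integral_modeEnergy_one_nonneg {T a : ℝ} (hT : 0 < T) (hTtanh : T * tanh T = 1)
    (ha : a = 1 / (T * cosh T)) {A A' A'' : ℝ → ℝ}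
    (hA : ∀ s, HasDerivAt A (A' s) s) (hA' : ∀ s, HasDerivAt A' (A'' s) s)
    (hode : ∀ s ∈ Ioo (-T) T, A'' s = (1 - 2 / cosh s ^ 2) * A s) :
    0 ≤ ∫ s in (-T)..T, modeEnergy a 1 A A' s := by
  have hc : ∀ s, cosh s ≠ 0 := fun s => (cosh_pos s).ne'
  have hg : ∀ s, HasDerivAt (fun s => 1 / cosh s) (-(sinh s / cosh s ^ 2)) s := fun s => by
    refine ((hasDerivAt_const s (1 : ℝ)).div (hasDerivAt_cosh s) (hc s)).congr_deriv ?_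
    ring
  have hg' : ∀ s, HasDerivAt (fun s => -(sinh s / cosh s ^ 2))
      ((1 - 2 / cosh s ^ 2) * (1 / cosh s)) s := fun s => by
    refine ((hasDerivAt_sinh s).div ((hasDerivAt_cosh s).pow 2)
      (pow_ne_zero 2 (hc s))).neg.congr_deriv ?_
    have := hc s
    simp
    field_simp
    linear_combination (-2) * cosh_sq s
  have hh : ∀ s, HasDerivAt (fun s => sinh s + s * (1 / cosh s))
      (cosh s + (1 / cosh s + s * -(sinh s / cosh s ^ 2))) s :=
    fun s => ((hasDerivAt_sinh s).add ((hasDerivAt_id s).mul (hg s))).congr_deriv (by simp)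
  have hh' : ∀ s, HasDerivAt (fun s => cosh s + (1 / cosh s + s * -(sinh s / cosh s ^ 2)))
      ((1 - 2 / cosh s ^ 2) * (sinh s + s * (1 / cosh s))) s :=
    fun s => ((hasDerivAt_cosh s).add ((hg s).add ((hasDerivAt_id s).mul (hg' s)))).congr_deriv
      (by simp; ring)
  have hW1 := fun s (hs : s ∈ Icc (-T) T) =>
    wronskian_eq hA hA' hh hh' (fun x hx => by rw [hode x hx]; ring) hs
  have hW2 := fun s (hs : s ∈ Icc (-T) T) =>
    wronskian_eq hA hA' hg hg' (fun x hx => by rw [hode x hx]; ring) hs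
  obtain ⟨α, hα⟩ : ∃ α, ∀ s ∈ Icc (-T) T, α = -(A' s * (sinh s + s * (1 / cosh s))
      - A s * (cosh s + (1 / cosh s + s * -(sinh s / cosh s ^ 2)))) / 2 :=
    ⟨_, fun s hs => by rw [hW1 s hs]⟩
  obtain ⟨β, hβ⟩ : ∃ β, ∀ s ∈ Icc (-T) T,
      β = (A' s * (1 / cosh s) - A s * -(sinh s / cosh s ^ 2)) / 2 :=
    ⟨_, fun s hs => by rw [hW2 s hs]⟩
  have hAs : ∀ s ∈ Icc (-T) T,
      A s = α * (1 / cosh s) + β * (sinh s + s * (1 / cosh s)) := fun s hs => by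
    rw [hα s hs, hβ s hs]
    have := hc s
    field_simp
    linear_combination (A s * cosh s) * cosh_sq s
  have hAs' : ∀ s ∈ Icc (-T) T, A' s = α * -(sinh s / cosh s ^ 2)
      + β * (cosh s + (1 / cosh s + s * -(sinh s / cosh s ^ 2))) := fun s hs => by
    rw [hα s hs, hβ s hs]
    have := hc s
    field_simp
    linear_combination (A' s * cosh s ^ 2) * cosh_sq s
  have hK : ∀ s, HasDerivAt (fun s => α ^ 2 * s + α * β * (sinh s ^ 2 + s ^ 2))
      (α ^ 2 + 2 * α * β * (sinh s * cosh s + s)) s := fun s => by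
    have hid := hasDerivAt_id s
    refine ((hid.const_mul (α ^ 2)).add ((((hasDerivAt_sinh s).pow 2).add
      (hid.pow 2)).const_mul (α * β))).congr_deriv ?_
    simp
    ring
  have hmain := integral_modeEnergy_ge hT a 1 hA hA' hode hK
    (by fun_prop) (fun s hs => by
      rw [hAs s hs]
      have := hc s
      have e : cosh s ^ 2 * (α * (1 / cosh s) + β * (sinh s + s * (1 / cosh s))) ^ 2
        = (α + β * (sinh s * cosh s + s)) ^ 2 := by field_simp
      rw [e]
      nlinarith [sq_nonneg (β * (sinh s * cosh s + s))])
  refine le_trans (le_of_eq ?_) hmain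
  have hTm : T ∈ Icc (-T) T := ⟨by linarith, le_rfl⟩
  have hTm' : -T ∈ Icc (-T) T := ⟨le_rfl, by linarith⟩
  rw [hAs T hTm, hAs' T hTm, hAs (-T) hTm', hAs' (-T) hTm']
  simp only [cosh_neg, sinh_neg]
  have hT0 := hT.ne'
  have hs : sinh T = cosh T / T := by
    rw [tanh_eq_sinh_div_cosh] at hTtanh
    have := hc T
    field_simp at hTtanh ⊢
    linarith
  have hsq : cosh T ^ 2 * (T ^ 2 - 1) = T ^ 2 := by
    have := cosh_sq T
    rw [hs] at this
    field_simp at this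
    linarith
  have ht : tanh T = 1 / T := by field_simp; linarith
  rw [hs, ht, ha]
  have := hc T
  field_simp
  linear_combination (-2 * β ^ 2 * T * (cosh T ^ 2 + T ^ 2)) * hsq

/-- Integrating the Jacobi equation in `θ` against a Laplace eigenfunction `φ` of the circle reduces
it to an ordinary differential equation in `s`. -/
lemma integral_mul_eigenfunction_of_jacobi {w wss wt wtt : ℝ → ℝ → ℝ} {φ φ' : ℝ → ℝ} {k s : ℝ}
    (hws : Continuous (w s)) (hwtt : Continuous (wtt s))
    (hwt : ∀ θ, HasDerivAt (w s) (wt s θ) θ) (hwt' : ∀ θ, HasDerivAt (wt s) (wtt s θ) θ)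
    (hper : ∀ θ, w s (θ + 2 * π) = w s θ)
    (hφ : ∀ θ, HasDerivAt φ (φ' θ) θ) (hφ' : ∀ θ, HasDerivAt φ' (-k * φ θ) θ)
    (hφp : φ (2 * π) = φ 0) (hφp' : φ' (2 * π) = φ' 0)
    (hjac : ∀ θ, wss s θ + wtt s θ + 2 / cosh s ^ 2 * w s θ = 0) :
    ∫ θ in (0:ℝ)..(2 * π), wss s θ * φ θ
      = (k - 2 / cosh s ^ 2) * ∫ θ in (0:ℝ)..(2 * π), w s θ * φ θ := by
  have hφc : Continuous φ := continuous_iff_continuousAt.2 fun x => (hφ x).continuousAt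
  have hw0 : w s (2 * π) = w s 0 := by simpa using hper 0
  have hwt0 : wt s (2 * π) = wt s 0 := by
    have h1 : HasDerivAt (fun θ => w s (θ + 2 * π)) (wt s (0 + 2 * π)) 0 :=
      (hwt (0 + 2 * π)).comp_add_const 0 (2 * π)
    rw [funext hper, zero_add] at h1
    exact h1.unique (hwt 0)
  have hparts := integral_eq_sub_of_hasDerivAt (a := 0) (b := 2 * π)
    (f := fun θ => wt s θ * φ θ - w s θ * φ' θ)
    (f' := fun θ => wtt s θ * φ θ + k * (w s θ * φ θ))
    (fun θ _ => (((hwt' θ).mul (hφ θ)).sub ((hwt θ).mul (hφ' θ))).congr_deriv (by ring))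
    (Continuous.intervalIntegrable (by fun_prop) _ _)
  rw [hw0, hwt0, hφp, hφp', sub_self] at hparts
  have h2 : ∀ θ, wss s θ * φ θ = (k - 2 / cosh s ^ 2) * (w s θ * φ θ)
      - (wtt s θ * φ θ + k * (w s θ * φ θ)) := fun θ => by
    linear_combination φ θ * hjac θ
  simp_rw [h2]
  rw [integral_sub (Continuous.intervalIntegrable (by fun_prop) _ _)
    (Continuous.intervalIntegrable (by fun_prop) _ _), hparts, sub_zero, integral_const_mul]

/-- Lower bound of the energy on a circle by the contributions of the Fourier modes `0` and `1`. -/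
lemma circle_energy_ge {f f' g : ℝ → ℝ} {t m : ℝ} (hf : ∀ x, HasDerivAt f (f' x) x)
    (hf' : Continuous f') (hg : Continuous g) (hper : f (2 * π) = f 0) (hm : -4 ≤ m) :
    1 / (2 * π) * (((∫ x in (0:ℝ)..(2 * π), g x * 1) - t * ∫ x in (0:ℝ)..(2 * π), f x * 1) ^ 2
        + m * (∫ x in (0:ℝ)..(2 * π), f x * 1) ^ 2)
      + 1 / π * (((∫ x in (0:ℝ)..(2 * π), g x * cos x) - t * ∫ x in (0:ℝ)..(2 * π), f x * cos x) ^ 2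
        + (1 + m) * (∫ x in (0:ℝ)..(2 * π), f x * cos x) ^ 2)
      + 1 / π * (((∫ x in (0:ℝ)..(2 * π), g x * sin x) - t * ∫ x in (0:ℝ)..(2 * π), f x * sin x) ^ 2
        + (1 + m) * (∫ x in (0:ℝ)..(2 * π), f x * sin x) ^ 2)
      ≤ ∫ x in (0:ℝ)..(2 * π), ((g x - t * f x) ^ 2 + f' x ^ 2 + m * f x ^ 2) := by
  have hfc : Continuous f := continuous_iff_continuousAt.2 fun x => (hf x).continuousAt
  have hlin : ∀ φ : ℝ → ℝ, Continuous φ → ∫ x in (0:ℝ)..(2 * π), (g x - t * f x) * φ x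
      = (∫ x in (0:ℝ)..(2 * π), g x * φ x) - t * ∫ x in (0:ℝ)..(2 * π), f x * φ x := by
    intro φ hφ
    rw [← integral_const_mul, ← integral_sub (Continuous.intervalIntegrable (by fun_prop) _ _)
      (Continuous.intervalIntegrable (by fun_prop) _ _)]
    congr 1 with x
    ring
  have hsplit : ∫ x in (0:ℝ)..(2 * π), ((g x - t * f x) ^ 2 + f' x ^ 2 + m * f x ^ 2)
      = (∫ x in (0:ℝ)..(2 * π), (g x - t * f x) ^ 2) + (∫ x in (0:ℝ)..(2 * π), f' x ^ 2)
        + m * ∫ x in (0:ℝ)..(2 * π), f x ^ 2 := by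
    rw [integral_add (Continuous.intervalIntegrable (by fun_prop) _ _)
      (Continuous.intervalIntegrable (by fun_prop) _ _),
      integral_add (Continuous.intervalIntegrable (by fun_prop) _ _)
      (Continuous.intervalIntegrable (by fun_prop) _ _), integral_const_mul]
  have hB := bessel_two_modes (f := fun x => g x - t * f x) (by fun_prop)
  have hBf := mul_le_mul_of_nonneg_left (bessel_two_modes hfc) (by linarith : 0 ≤ m + 4)
  have hW := wirtinger_two_modes hf hf' hper
  have h1 := hlin (fun _ => 1) continuous_const
  simp only [mul_one] at h1
  rw [hlin _ continuous_cos, hlin _ continuous_sin, h1] at hB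
  rw [hsplit]
  simp only [mul_one]
  have := pi_pos
  rw [← sub_nonneg, ← mul_nonneg_iff_of_pos_left (by positivity : 0 < 2 * π)]
  field_simp
  linarith

/-- Completing the square with `tanh` absorbs the boundary terms of the index form. -/
lemma integral_sub_boundary_eq {T a : ℝ} (hT : 0 < T) (hTtanh : T * tanh T = 1) {f f' g : ℝ → ℝ}
    (hf : ∀ s, HasDerivAt f (f' s) s) (hf' : Continuous f') (hg : Continuous g) :
    (∫ s in (-T)..T, (f' s * f' s + g s * g s - 2 / cosh s ^ 2 * f s * f s))
        - 1 / T * (f T * f T + f (-T) * f (-T))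
        + 2 * a ^ 2 * ∫ s in (-T)..T, cosh s ^ 2 * f s ^ 2
      = ∫ s in (-T)..T, ((f' s - tanh s * f s) ^ 2 + g s ^ 2
          + (-1 - 2 / cosh s ^ 2 + 2 * a ^ 2 * cosh s ^ 2) * f s ^ 2) := by
  have hfc : Continuous f := continuous_iff_continuousAt.2 fun x => (hf x).continuousAt
  have htc := continuous_real_tanh
  have hc : ∀ s, cosh s ≠ 0 := fun s => (cosh_pos s).ne'
  have hc2 : ∀ s, cosh s ^ 2 ≠ 0 := fun s => pow_ne_zero 2 (hc s)
  have hftc := integral_eq_sub_of_hasDerivAt (a := -T) (b := T)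
    (fun s _ => (hasDerivAt_real_tanh s).mul ((hf s).pow 2))
    (Continuous.intervalIntegrable (by fun_prop (disch := exact hc2 _)) _ _)
  have ht : tanh T = 1 / T := by field_simp; linarith
  simp only [Pi.mul_apply, Pi.pow_apply, tanh_neg, ht] at hftc
  have hb : 1 / T * (f T * f T + f (-T) * f (-T)) = 1 / T * f T ^ 2 - -(1 / T) * f (-T) ^ 2 := by
    ring
  rw [hb, ← hftc, ← integral_const_mul,
    ← integral_sub (Continuous.intervalIntegrable (by fun_prop (disch := exact hc2 _)) _ _)
      (Continuous.intervalIntegrable (by fun_prop (disch := exact hc2 _)) _ _),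
    ← integral_add (Continuous.intervalIntegrable (by fun_prop (disch := exact hc2 _)) _ _)
      (Continuous.intervalIntegrable (by fun_prop) _ _)]
  congr 1 with s
  have := hc s
  rw [tanh_eq_sinh_div_cosh]
  simp
  field_simp
  linear_combination (f s ^ 2) * cosh_sq s

/-- Every smooth, `2π`-periodic in `θ` function `w` satisfying the Jacobi equation on
`(-T,T) × ℝ` satisfies `B(w,w) ≥ -2 N₂(w)` (the paper's Corollary instantiated on the
critical catenoid, which has index 4). -/
theorem jacobi_fields_lower_bound (T a : ℝ) (hT : 0 < T)
    (hTtanh : T * Real.tanh T = 1) (ha : a = 1 / (T * Real.cosh T))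
    (w : ℝ → ℝ → ℝ)
    (hw_smooth : ContDiff ℝ (⊤ : ℕ∞) (Function.uncurry w))
    (hw_per : ∀ s θ : ℝ, w s (θ + 2 * Real.pi) = w s θ)
    (hw_jacobi : ∀ s ∈ Set.Ioo (-T) T, ∀ θ : ℝ,
      iteratedDeriv 2 (fun s' => w s' θ) s + iteratedDeriv 2 (fun θ' => w s θ') θ
        + 2 / (Real.cosh s) ^ 2 * w s θ = 0) :
    indexForm T w w ≥ -2 * catL2 T a w := by
  obtain ⟨ws, hws, hdws⟩ := hw_smooth.exists_partial_fst
  obtain ⟨wss, hwss, hdwss⟩ := hws.exists_partial_fst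
  obtain ⟨wt, hwt, hdwt⟩ := hw_smooth.exists_partial_snd
  obtain ⟨wtt, hwtt, hdwtt⟩ := hwt.exists_partial_snd
  replace hw_smooth := hw_smooth.continuous
  replace hws := hws.continuous
  replace hwss := hwss.continuous
  replace hwt := hwt.continuous
  replace hwtt := hwtt.continuous
  have hjac : ∀ s ∈ Ioo (-T) T, ∀ θ, wss s θ + wtt s θ + 2 / cosh s ^ 2 * w s θ = 0 := by
    intro s hs θ
    have h := hw_jacobi s hs θ
    have e1 : deriv (fun s' => w s' θ) = fun s' => ws s' θ := funext fun x => (hdws x θ).deriv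
    have e2 : deriv (fun θ' => w s θ') = fun θ' => wt s θ' := funext fun x => (hdwt s x).deriv
    simp only [iteratedDeriv_succ, iteratedDeriv_zero] at h
    rwa [e1, e2, (hdwss s θ).deriv, (hdwtt s θ).deriv] at h
  have hderiv : ∀ {F G : ℝ → ℝ → ℝ} {φ : ℝ → ℝ}, Continuous (Function.uncurry F) →
      Continuous (Function.uncurry G) → (∀ s θ, HasDerivAt (fun s' => F s' θ) (G s θ) s) →
      Continuous φ → ∀ s, HasDerivAt (fun s => ∫ θ in (0:ℝ)..(2 * π), F s θ * φ θ)
        (∫ θ in (0:ℝ)..(2 * π), G s θ * φ θ) s := fun {F G φ} hF hG hFG hφ s =>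
    hasDerivAt_intervalIntegral_of_continuous (F := fun s θ => F s θ * φ θ)
      (G := fun s θ => G s θ * φ θ) (hF.mul (hφ.comp continuous_snd))
      (hG.mul (hφ.comp continuous_snd)) (fun s θ => (hFG s θ).mul_const _) _ _ s
  have hode : ∀ {φ φ' : ℝ → ℝ} {k : ℝ}, (∀ θ, HasDerivAt φ (φ' θ) θ) →
      (∀ θ, HasDerivAt φ' (-k * φ θ) θ) → φ (2 * π) = φ 0 → φ' (2 * π) = φ' 0 →
      ∀ s ∈ Ioo (-T) T, ∫ θ in (0:ℝ)..(2 * π), wss s θ * φ θ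
        = (k - 2 / cosh s ^ 2) * ∫ θ in (0:ℝ)..(2 * π), w s θ * φ θ :=
    fun hφ hφ' hp hp' s hs =>
      integral_mul_eigenfunction_of_jacobi (hw_smooth.uncurry_left s)
        (hwtt.uncurry_left s) (hdwt s) (hdwtt s) (hw_per s) hφ hφ' hp hp' (hjac s hs)
  have hcoeff : ∀ {φ : ℝ → ℝ}, Continuous φ → ∀ k, Continuous (modeEnergy a k
      (fun s => ∫ θ in (0:ℝ)..(2 * π), w s θ * φ θ)
      (fun s => ∫ θ in (0:ℝ)..(2 * π), ws s θ * φ θ)) := fun hφ k =>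
    continuous_modeEnergy a k
      (continuous_parametric_intervalIntegral_of_continuous'
        (hw_smooth.mul (hφ.comp continuous_snd)) _ _)
      (continuous_parametric_intervalIntegral_of_continuous'
        (hws.mul (hφ.comp continuous_snd)) _ _)
  have h0 := integral_modeEnergy_zero_nonneg hT hTtanh ha
    (hderiv hw_smooth hws hdws (continuous_const (y := (1 : ℝ))))
    (hderiv hws hwss hdwss (continuous_const (y := (1 : ℝ))))
    (fun s hs => by
      rw [hode (φ := fun _ => 1) (φ' := fun _ => 0) (k := 0) (fun θ => hasDerivAt_const θ 1)
        (fun θ => (hasDerivAt_const θ 0).congr_deriv (by simp)) rfl rfl s hs]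
      ring)
  have h1 := integral_modeEnergy_one_nonneg hT hTtanh ha
    (hderiv hw_smooth hws hdws continuous_cos) (hderiv hws hwss hdwss continuous_cos)
    (hode hasDerivAt_cos (fun θ => (hasDerivAt_sin θ).neg.congr_deriv (by ring))
      (by simp) (by simp))
  have h2 := integral_modeEnergy_one_nonneg hT hTtanh ha
    (hderiv hw_smooth hws hdws continuous_sin) (hderiv hws hwss hdwss continuous_sin)
    (hode hasDerivAt_sin (fun θ => (hasDerivAt_cos θ).congr_deriv (by ring))
      (by simp) (by simp))
  set J : ℝ → ℝ → ℝ := fun θ s => (ws s θ - tanh s * w s θ) ^ 2 + wt s θ ^ 2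
    + (-1 - 2 / cosh s ^ 2 + 2 * a ^ 2 * cosh s ^ 2) * w s θ ^ 2 with hJ
  have hc2 : ∀ s, cosh s ^ 2 ≠ 0 := fun s => pow_ne_zero 2 (cosh_pos s).ne'
  have htc := continuous_real_tanh
  have hJc : Continuous (Function.uncurry J) := by
    have e1 : Continuous fun p : ℝ × ℝ => w p.2 p.1 := hw_smooth.comp continuous_swap
    have e2 : Continuous fun p : ℝ × ℝ => ws p.2 p.1 := hws.comp continuous_swap
    have e3 : Continuous fun p : ℝ × ℝ => wt p.2 p.1 := hwt.comp continuous_swap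
    simp only [hJ, Function.uncurry_def]
    fun_prop (disch := exact fun _ => hc2 _)
  have hfib : ∀ s, 1 / (2 * π) * modeEnergy a 0 (fun s => ∫ θ in (0:ℝ)..(2 * π), w s θ * 1)
        (fun s => ∫ θ in (0:ℝ)..(2 * π), ws s θ * 1) s
      + 1 / π * modeEnergy a 1 (fun s => ∫ θ in (0:ℝ)..(2 * π), w s θ * cos θ)
        (fun s => ∫ θ in (0:ℝ)..(2 * π), ws s θ * cos θ) s
      + 1 / π * modeEnergy a 1 (fun s => ∫ θ in (0:ℝ)..(2 * π), w s θ * sin θ)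
        (fun s => ∫ θ in (0:ℝ)..(2 * π), ws s θ * sin θ) s
      ≤ ∫ θ in (0:ℝ)..(2 * π), J θ s := by
    intro s
    refine le_trans (le_of_eq ?_) (circle_energy_ge (t := tanh s) (hdwt s) (hwt.uncurry_left s)
      (hws.uncurry_left s) (by simpa using hw_per s 0) ?_)
    · simp only [modeEnergy]
      ring
    · have h3 : 2 / cosh s ^ 2 ≤ 2 := by
        rw [div_le_iff₀ (pow_pos (cosh_pos s) 2)]
        nlinarith [cosh_sq s, sq_nonneg (sinh s)]
      have h4 : 0 ≤ 2 * a ^ 2 * cosh s ^ 2 := by positivity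
      linarith
  have hJint : 0 ≤ ∫ θ in (0:ℝ)..(2 * π), ∫ s in (-T)..T, J θ s := by
    rw [MeasureTheory.intervalIntegral_intervalIntegral_swap
      ((hJc.continuousOn.integrableOn_compact (isCompact_uIcc.prod isCompact_uIcc)).mono_set
        (prod_mono uIoc_subset_uIcc uIoc_subset_uIcc))]
    have i0 := hcoeff (continuous_const (y := (1 : ℝ))) 0
    have i1 := hcoeff continuous_cos 1
    have i2 := hcoeff continuous_sin 1
    have hmono := integral_mono_on (μ := MeasureTheory.volume) (by linarith : -T ≤ T)
      (Continuous.intervalIntegrable (by fun_prop) _ _)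
      ((continuous_parametric_intervalIntegral_of_continuous' (f := fun s θ => J θ s)
        (hJc.comp continuous_swap) 0 (2 * π)).intervalIntegrable _ _) (fun s _ => hfib s)
    refine le_trans ?_ hmono
    rw [integral_add (Continuous.intervalIntegrable (by fun_prop) _ _)
      (Continuous.intervalIntegrable (by fun_prop) _ _),
      integral_add (Continuous.intervalIntegrable (by fun_prop) _ _)
      (Continuous.intervalIntegrable (by fun_prop) _ _), integral_const_mul, integral_const_mul,
      integral_const_mul]
    have := pi_pos
    positivity
  suffices h : indexForm T w w + 2 * catL2 T a w = ∫ θ in (0:ℝ)..(2 * π), ∫ s in (-T)..T, J θ s by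
    linarith
  have hinner : ∀ θ, ∫ s in (-T)..T, J θ s = _ := fun θ =>
    (integral_sub_boundary_eq (a := a) hT hTtanh (fun s => hdws s θ) (hws.uncurry_right θ)
      (hwt.uncurry_right θ)).symm
  have e1 : Continuous fun p : ℝ × ℝ => w p.2 p.1 := hw_smooth.comp continuous_swap
  have e2 : Continuous fun p : ℝ × ℝ => ws p.2 p.1 := hws.comp continuous_swap
  have e3 : Continuous fun p : ℝ × ℝ => wt p.2 p.1 := hwt.comp continuous_swap
  have c1 := continuous_parametric_intervalIntegral_of_continuous' (μ := MeasureTheory.volume)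
    (f := fun θ s => ws s θ * ws s θ + wt s θ * wt s θ - 2 / cosh s ^ 2 * w s θ * w s θ)
    (by
      simp only [Function.uncurry_def]
      fun_prop (disch := exact fun _ => hc2 _)) (-T) T
  have c2 := continuous_parametric_intervalIntegral_of_continuous' (μ := MeasureTheory.volume)
    (f := fun θ s => cosh s ^ 2 * w s θ ^ 2)
    (by
      simp only [Function.uncurry_def]
      fun_prop) (-T) T
  have c3 : ∀ s, Continuous (w s) := fun s => hw_smooth.uncurry_left s
  simp only [hinner]
  rw [integral_add (Continuous.intervalIntegrable (by fun_prop) _ _)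
      (Continuous.intervalIntegrable (by fun_prop) _ _),
    integral_sub (Continuous.intervalIntegrable (by fun_prop) _ _)
      (Continuous.intervalIntegrable (by fun_prop) _ _), integral_const_mul, integral_const_mul]
  simp only [indexForm, catL2, (hdws _ _).deriv, (hdwt _ _).deriv]
  ring
end
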